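/- arXiv:2502.09830 — 3 statements merged into one kernel-verified Lean document; each statement's English description precedes it below -/
import Mathlib

section
/- Every graph containing a cycle is Ramsey infinite, i.e., for every graph F that contains a cycle there are infinitely many (pairwise non-isomorphic) graphs G that satisfy G →nni (F)_2 and are minimal with this property (no proper subgraph G' ⊊ G satisfies G' →nni (F)_2). -/
open SimpleGraph

/-- `G →nni (F)_r` : every `r`-colouring of the edges of `G` yields a monochromatic
(not necessarily induced) subgraph of `G` isomorphic to `F`. -/
def ArrowNNI {V α : Type*} (G : SimpleGraph V) (F : SimpleGraph α) (r : ℕ) : Prop :=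
  ∀ c : Sym2 V → Fin r, ∃ f : F →g G, Function.Injective f ∧
    ∃ k : Fin r, ∀ x y, F.Adj x y → c s(f x, f y) = k

/-- The total weight of the sets containing `J`. -/
noncomputable def weightDegree {V : Type} [Fintype V] [DecidableEq V] (w : Finset V → ℝ)
    (J : Finset V) : ℝ :=
  ∑ e with J ⊆ e, w e

/-- The hypergraph left after deleting all sets that contain a saturated set. -/
noncomputable def unsaturated {V : Type} (w : Finset V → ℝ) (sat : Finset V → Prop) (e : Finset V) : ℝ :=
  open Classical in if ∃ J ⊆ e, sat J then 0 else w e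

lemma unsaturated_le {V : Type} {w : Finset V → ℝ} (hw : ∀ e, 0 ≤ w e) (sat : Finset V → Prop)
    (e : Finset V) : unsaturated w sat e ≤ w e := by
  unfold unsaturated; split_ifs
  · exact hw e
  · exact le_rfl

lemma unsaturated_nonneg {V : Type} {w : Finset V → ℝ} (hw : ∀ e, 0 ≤ w e) (sat : Finset V → Prop)
    (e : Finset V) : 0 ≤ unsaturated w sat e := by
  unfold unsaturated; split_ifs
  · exact le_rfl
  · exact hw e

lemma ne_zero_of_unsaturated {V : Type} {w : Finset V → ℝ} {sat : Finset V → Prop}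
    {e : Finset V} (h : unsaturated w sat e ≠ 0) : w e ≠ 0 := by
  unfold unsaturated at h; split_ifs at h
  · exact absurd rfl h
  · exact h

section Containers

variable {V : Type} [Fintype V] [DecidableEq V]

lemma weightDegree_empty (w : Finset V → ℝ) : weightDegree w ∅ = ∑ e, w e := by
  simp [weightDegree]

lemma weightDegree_nonneg {w : Finset V → ℝ} (hw : ∀ e, 0 ≤ w e) (J : Finset V) :
    0 ≤ weightDegree w J :=
  Finset.sum_nonneg fun e _ => hw e

lemma weightDegree_mono {w w' : Finset V → ℝ} (h : ∀ e, w e ≤ w' e) (J : Finset V) :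
    weightDegree w J ≤ weightDegree w' J :=
  Finset.sum_le_sum fun e _ => h e

lemma weightDegree_add (w w' : Finset V → ℝ) (J : Finset V) :
    weightDegree (fun e => w e + w' e) J = weightDegree w J + weightDegree w' J :=
  Finset.sum_add_distrib

lemma sum_weightDegree (w : Finset V → ℝ) :
    ∑ J, weightDegree w J = ∑ e, 2 ^ e.card * w e := by
  simp only [weightDegree, Finset.sum_filter]
  rw [Finset.sum_comm]
  refine Finset.sum_congr rfl fun e _ => ?_
  rw [← Finset.sum_filter, Finset.sum_const, nsmul_eq_mul]
  congr 1
  have : (Finset.univ.filter fun J : Finset V => J ⊆ e) = e.powerset := by ext; simp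
  rw [this, Finset.card_powerset]; simp

lemma sum_weightDegree_singleton (w : Finset V → ℝ) :
    ∑ v, weightDegree w {v} = ∑ e, e.card * w e := by
  simp only [weightDegree, Finset.sum_filter]
  rw [Finset.sum_comm]
  refine Finset.sum_congr rfl fun e _ => ?_
  rw [← Finset.sum_filter, Finset.sum_const, nsmul_eq_mul]
  congr 2
  congr 1
  ext; simp

/-- The link of a vertex in a weighted hypergraph. -/
def weightLink (w : Finset V → ℝ) (v : V) (e : Finset V) : ℝ :=
  if v ∈ e then 0 else w (insert v e)

lemma weightDegree_link_of_mem (w : Finset V → ℝ) {v : V} {J : Finset V} (h : v ∈ J) :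
    weightDegree (weightLink w v) J = 0 := by
  refine Finset.sum_eq_zero fun e he => ?_
  rw [weightLink, if_pos ((Finset.mem_filter.1 he).2 h)]

lemma weightDegree_link_of_notMem (w : Finset V → ℝ) {v : V} {J : Finset V} (h : v ∉ J) :
    weightDegree (weightLink w v) J = weightDegree w (insert v J) := by
  have : weightDegree (weightLink w v) J
      = ∑ e with (J ⊆ e ∧ v ∉ e), w (insert v e) := by
    rw [weightDegree, Finset.sum_filter, Finset.sum_filter]
    refine Finset.sum_congr rfl fun e _ => ?_
    by_cases h1 : J ⊆ e <;> by_cases h2 : v ∈ e <;> simp [weightLink, h1, h2]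
  rw [this, weightDegree]
  refine Finset.sum_bij' (fun e _ => insert v e) (fun e _ => e.erase v) ?_ ?_ ?_ ?_ ?_
  · intro e he
    simp only [Finset.mem_filter, Finset.mem_univ, true_and] at he ⊢
    exact Finset.insert_subset_insert _ he.1
  · intro e he
    simp only [Finset.mem_filter, Finset.mem_univ, true_and] at he ⊢
    refine ⟨fun x hx => Finset.mem_erase.2 ⟨?_, he (Finset.mem_insert_of_mem hx)⟩, by simp⟩
    rintro rfl; exact h hx
  · intro e he
    simp only [Finset.mem_filter, Finset.mem_univ, true_and] at he
    exact Finset.erase_insert he.2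
  · intro e he
    simp only [Finset.mem_filter, Finset.mem_univ, true_and] at he
    exact Finset.insert_erase (he (Finset.mem_insert_self _ _))
  · intros; rfl

lemma weightDegree_unsaturated_of_sat (w : Finset V → ℝ) {sat : Finset V → Prop}
    {J J' : Finset V} (hJ : sat J) (h : J ⊆ J') : weightDegree (unsaturated w sat) J' = 0 := by
  refine Finset.sum_eq_zero fun e he => ?_
  rw [unsaturated, if_pos ⟨J, h.trans (Finset.mem_filter.1 he).2, hJ⟩]

/-- Few edges are lost to saturation. -/
lemma sum_sub_unsaturated_le {w G : Finset V → ℝ} {i : ℕ} {q D : ℝ} (hq : 0 < q)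
    (hw : ∀ e, 0 ≤ w e) (hG : ∀ e, 0 ≤ G e) (hGu : ∀ e, G e ≠ 0 → e.card = i)
    (hdeg : ∀ J : Finset V, J.Nonempty → weightDegree w J ≤ q ^ (J.card - 1) * D) :
    ∑ e, w e - ∑ e, unsaturated w
      (fun J => J.Nonempty ∧ q ^ J.card * D ≤ weightDegree G J) e ≤ 2 ^ i * (∑ e, G e) / q := by
  classical
  set sat : Finset V → Prop := fun J => J.Nonempty ∧ q ^ J.card * D ≤ weightDegree G J with hsat
  have h1 : ∑ e, w e - ∑ e, unsaturated w sat e ≤ ∑ J with sat J, weightDegree w J := by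
    rw [← Finset.sum_sub_distrib]
    simp only [weightDegree]
    rw [Finset.sum_comm' (t' := Finset.univ)
      (s' := fun e => Finset.univ.filter fun J => sat J ∧ J ⊆ e) (by intro x y; simp)]
    refine Finset.sum_le_sum fun e _ => ?_
    unfold unsaturated
    split_ifs with h
    · obtain ⟨J, hJ, hs⟩ := h
      rw [sub_zero]
      exact Finset.single_le_sum (f := fun _ => w e) (fun _ _ => hw e)
        (Finset.mem_filter.2 ⟨Finset.mem_univ J, hs, hJ⟩)
    · rw [sub_self]; exact Finset.sum_nonneg fun _ _ => hw e
  have h2 : ∑ J with sat J, weightDegree w J ≤ ∑ J, weightDegree G J / q := by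
    refine (Finset.sum_le_sum fun J hJ => ?_).trans
      (Finset.sum_le_sum_of_subset_of_nonneg (Finset.filter_subset sat _)
        fun J _ _ => div_nonneg (weightDegree_nonneg hG J) hq.le)
    have hJ := (Finset.mem_filter.1 hJ).2
    refine (hdeg J hJ.1).trans ?_
    rw [le_div_iff₀ hq]
    refine le_trans (le_of_eq ?_) hJ.2
    have : J.card = J.card - 1 + 1 := by have := hJ.1.card_pos; omega
    conv_rhs => rw [this, pow_succ]
    ring
  refine h1.trans (h2.trans (le_of_eq ?_))
  rw [← Finset.sum_div, sum_weightDegree, Finset.mul_sum]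
  congr 1
  refine Finset.sum_congr rfl fun e _ => ?_
  by_cases h : G e = 0
  · simp [h]
  · rw [hGu e h]

/-- Many vertices have large degree. -/
lemma card_high_degree {A : Finset V → ℝ} {i : ℕ} {c D : ℝ} (hD : 0 < D) (hc : 0 < c)
    (hA : ∀ e, 0 ≤ A e) (hAu : ∀ e, A e ≠ 0 → e.card = i + 1)
    (hdeg : ∀ v, weightDegree A {v} ≤ D)
    (htot : c / 2 * Fintype.card V * D ≤ ∑ e, A e) :
    c / 4 * Fintype.card V ≤
      ((Finset.univ.filter fun v => c / 4 * D < weightDegree A {v}).card : ℝ) := by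
  have h1 : ∑ e, A e ≤ ∑ v, weightDegree A {v} := by
    rw [sum_weightDegree_singleton]
    refine Finset.sum_le_sum fun e _ => ?_
    by_cases h : A e = 0
    · simp [h]
    · rw [hAu e h]; push_cast
      nlinarith [hA e, (Nat.cast_nonneg i : (0 : ℝ) ≤ i)]
  have h2 : ∑ v, weightDegree A {v} ≤
      ∑ v, ((if c / 4 * D < weightDegree A {v} then D else 0) + c / 4 * D) := by
    refine Finset.sum_le_sum fun v _ => ?_
    split_ifs with h
    · have := hdeg v; nlinarith
    · linarith
  rw [Finset.sum_add_distrib, ← Finset.sum_filter, Finset.sum_const, Finset.sum_const,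
    nsmul_eq_mul, nsmul_eq_mul, Finset.card_univ] at h2
  have h3 : c / 4 * Fintype.card V * D ≤
      ((Finset.univ.filter fun v => c / 4 * D < weightDegree A {v}).card : ℝ) * D := by linarith
  exact le_of_mul_le_mul_right h3 hD

/-- A uniform weighted hypergraph with well distributed weights admits few large sets such that
every independent set avoids one of them. -/
theorem exists_avoided_sets (l : ℕ) : ∀ c : ℝ, 0 < c → ∃ κ : ℝ, 0 < κ ∧
    ∀ (V : Type) [Fintype V] [DecidableEq V] [Nonempty V] (C : Finset V) (w : Finset V → ℝ)
      (D q : ℝ) (B : ℕ), 0 < D → 0 < q → 2 * q * Fintype.card V ≤ B →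
      (∀ e, 0 ≤ w e) → (∀ e, w e ≠ 0 → e.card = l) → (∀ e, w e ≠ 0 → e ⊆ C) →
      (∀ J : Finset V, J.Nonempty → weightDegree w J ≤ q ^ (J.card - 1) * D) →
      c * Fintype.card V * D ≤ ∑ e, w e →
      ∃ 𝓕 : Finset (Finset V), 𝓕.card ≤ (Fintype.card V + 1) ^ (B * l) ∧
        (∀ S ∈ 𝓕, S ⊆ C ∧ κ * Fintype.card V ≤ S.card) ∧
        ∀ I : Finset V, (∀ e ⊆ I, w e = 0) → ∃ S ∈ 𝓕, Disjoint S I := by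
  induction l with
  | zero =>
    intro c hc
    refine ⟨1, one_pos, ?_⟩
    intro V _ _ _ C w D q B hD hq hB hw hu hC hdeg htot
    refine ⟨∅, by simp, by simp, fun I hI => ?_⟩
    exfalso
    have h0 : ∑ e, w e = 0 := by
      refine Finset.sum_eq_zero fun e _ => ?_
      by_contra h
      have := Finset.card_eq_zero.1 (hu e h)
      subst this
      exact h (hI ∅ (Finset.empty_subset _))
    have : (0 : ℝ) < Fintype.card V := by exact_mod_cast Fintype.card_pos
    have : 0 < c * Fintype.card V * D := by positivity
    linarith
  | succ i ih =>
    intro c hc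
    obtain ⟨κ, hκ, ih⟩ := ih (c / 2 ^ (i + 3)) (by positivity)
    refine ⟨min κ (c / 4), by positivity, ?_⟩
    intro V _ _ _ C w D q B hD hq hB hw hu hC hdeg htot
    have hN : (0 : ℝ) < Fintype.card V := by exact_mod_cast Fintype.card_pos
    have key : ∀ (r : ℕ) (G : Finset V → ℝ), (∀ e, 0 ≤ G e) → (∀ e, G e ≠ 0 → e.card = i) →
        (∀ e, G e ≠ 0 → e ⊆ C) →
        (∀ J : Finset V, J.Nonempty → weightDegree G J ≤ 2 * q ^ J.card * D) →
        c / 2 ^ (i + 2) * Fintype.card V * q * D ≤ ∑ e, G e + r * (c / 4 * D) →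
        ∃ 𝓕 : Finset (Finset V), 𝓕.card ≤ (Fintype.card V + 1) ^ (r + B * i) ∧
        (∀ S ∈ 𝓕, S ⊆ C ∧ min κ (c / 4) * Fintype.card V ≤ S.card) ∧
        ∀ I : Finset V, (∀ e ⊆ I, w e = 0) → (∀ e ⊆ I, G e = 0) → ∃ S ∈ 𝓕, Disjoint S I := by
      intro r
      induction r with
      | zero =>
        intro G hG hGu hGC hGd hGt
        obtain ⟨𝓕, h1, h2, h3⟩ := ih V C G (2 * q * D) q B (by positivity) hq hB hG hGu hGC
          (fun J hJ => by
            refine (hGd J hJ).trans (le_of_eq ?_)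
            have : J.card = J.card - 1 + 1 := by have := hJ.card_pos; omega
            conv_lhs => rw [this, pow_succ]
            ring)
          (by
            refine le_trans (le_of_eq ?_) (hGt.trans (le_of_eq (by simp)))
            rw [pow_succ _ (i + 2)]; field_simp)
        refine ⟨𝓕, by simpa using h1, fun S hS => ⟨(h2 S hS).1, le_trans ?_ (h2 S hS).2⟩,
          fun I _ hI => h3 I hI⟩
        gcongr; exact min_le_left _ _
      | succ r ihr =>
        intro G hG hGu hGC hGd hGt
        by_cases hbig : c / 2 ^ (i + 2) * Fintype.card V * q * D ≤ ∑ e, G e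
        · obtain ⟨𝓕, h1, h2, h3⟩ := ihr G hG hGu hGC hGd (hbig.trans (by
            have : 0 ≤ (r : ℝ) * (c / 4 * D) := by positivity
            linarith))
          exact ⟨𝓕, h1.trans (Nat.pow_le_pow_right (by omega) (by omega)), h2, h3⟩
        push Not at hbig
        set sat : Finset V → Prop := fun J => J.Nonempty ∧ q ^ J.card * D ≤ weightDegree G J
          with hsat
        set A := unsaturated w sat with hA
        have hA0 : ∀ e, 0 ≤ A e := unsaturated_nonneg hw sat
        have hAw : ∀ e, A e ≤ w e := unsaturated_le hw sat
        have hAne : ∀ e, A e ≠ 0 → w e ≠ 0 := fun e he => ne_zero_of_unsaturated he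
        have hloss : c / 2 * Fintype.card V * D ≤ ∑ e, A e := by
          have h := sum_sub_unsaturated_le (w := w) (G := G) (i := i) hq hw hG hGu hdeg
          have h' : 2 ^ i * (∑ e, G e) / q ≤ c / 4 * Fintype.card V * D := by
            rw [div_le_iff₀ hq]
            calc 2 ^ i * (∑ e, G e) ≤ 2 ^ i * (c / 2 ^ (i + 2) * Fintype.card V * q * D) := by
                  gcongr
              _ = _ := by rw [pow_add]; field_simp; norm_num
          have : 0 < c * Fintype.card V * D := by positivity
          linarith
        have hAd : ∀ v, weightDegree A {v} ≤ D := fun v =>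
          (weightDegree_mono hAw _).trans ((hdeg {v} (by simp)).trans (by simp))
        set S₀ : Finset V := Finset.univ.filter fun v => c / 4 * D < weightDegree A {v} with hS₀
        have hS₀card := card_high_degree hD hc hA0 (fun e he => hu e (hAne e he)) hAd hloss
        have hnext : ∀ v, c / 4 * D < weightDegree A {v} → ∃ 𝓕 : Finset (Finset V),
            𝓕.card ≤ (Fintype.card V + 1) ^ (r + B * i) ∧
            (∀ S ∈ 𝓕, S ⊆ C ∧ min κ (c / 4) * Fintype.card V ≤ S.card) ∧
            ∀ I : Finset V, (∀ e ⊆ I, w e = 0) →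
              (∀ e ⊆ I, G e + weightLink A v e = 0) → ∃ S ∈ 𝓕, Disjoint S I := by
          intro v hv
          have hl0 : ∀ e, 0 ≤ weightLink A v e := fun e => by
            unfold weightLink; split_ifs
            · exact le_rfl
            · exact hA0 _
          have hlne : ∀ e, weightLink A v e ≠ 0 → v ∉ e ∧ w (insert v e) ≠ 0 := fun e he => by
            unfold weightLink at he; split_ifs at he with h
            · exact absurd rfl he
            · exact ⟨h, hAne _ he⟩
          have hsplit : ∀ e, G e + weightLink A v e ≠ 0 → G e ≠ 0 ∨ weightLink A v e ≠ 0 :=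
            fun e he => by
              by_contra! hcon
              exact he (by rw [hcon.1, hcon.2, add_zero])
          refine ihr (fun e => G e + weightLink A v e) (fun e => add_nonneg (hG e) (hl0 e))
            (fun e he => ?_) (fun e he => ?_) (fun J hJ => ?_) ?_
          · rcases hsplit e he with h | h
            · exact hGu e h
            · have := hu _ (hlne e h).2
              rw [Finset.card_insert_of_notMem (hlne e h).1] at this
              omega
          · rcases hsplit e he with h | h
            · exact hGC e h
            · exact (Finset.subset_insert v e).trans (hC _ (hlne e h).2)
          · rw [weightDegree_add]
            by_cases hvJ : v ∈ J
            · rw [weightDegree_link_of_mem _ hvJ, add_zero]; exact hGd J hJ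
            rw [weightDegree_link_of_notMem _ hvJ]
            by_cases hs : sat J
            · rw [weightDegree_unsaturated_of_sat w hs (Finset.subset_insert v J), add_zero]
              exact hGd J hJ
            · have h1 : weightDegree G J < q ^ J.card * D := by
                by_contra! h; exact hs ⟨hJ, h⟩
              have h2 := (weightDegree_mono hAw (insert v J)).trans
                (hdeg (insert v J) (Finset.insert_nonempty _ _))
              rw [Finset.card_insert_of_notMem hvJ, Nat.add_sub_cancel] at h2
              linarith
          · rw [Finset.sum_add_distrib, ← weightDegree_empty (weightLink A v),
              weightDegree_link_of_notMem _ (Finset.notMem_empty v)]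
            push_cast at hGt
            have : weightDegree A (insert v ∅) = weightDegree A {v} := rfl
            linarith
        choose! 𝓕 h𝓕1 h𝓕2 h𝓕3 using hnext
        refine ⟨insert S₀ (S₀.biUnion 𝓕), ?_, ?_, ?_⟩
        · refine (Finset.card_insert_le _ _).trans ?_
          have h1 : (S₀.biUnion 𝓕).card ≤
              Fintype.card V * (Fintype.card V + 1) ^ (r + B * i) := by
            refine (Finset.card_biUnion_le_card_mul S₀ 𝓕 _ fun v hv => ?_).trans
              (Nat.mul_le_mul_right _ (Finset.card_le_univ S₀))
            exact h𝓕1 v (Finset.mem_filter.1 hv).2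
          have h2 : 1 ≤ (Fintype.card V + 1) ^ (r + B * i) := Nat.one_le_pow _ _ (by omega)
          have h3 : (Fintype.card V + 1) ^ (r + 1 + B * i)
              = (Fintype.card V + 1) ^ (r + B * i) * (Fintype.card V + 1) := by
            rw [← pow_succ]; congr 1; omega
          rw [h3]; nlinarith
        · intro S hS
          rcases Finset.mem_insert.1 hS with rfl | hS
          · refine ⟨fun v hv => ?_, le_trans ?_ hS₀card⟩
            · have hv := (Finset.mem_filter.1 hv).2
              have hne : weightDegree A {v} ≠ 0 := by
                have : 0 < c / 4 * D := by positivity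
                linarith
              obtain ⟨e, he, hne⟩ := Finset.exists_ne_zero_of_sum_ne_zero hne
              exact hC e (hAne e hne) ((Finset.mem_filter.1 he).2 (Finset.mem_singleton_self v))
            · gcongr; exact min_le_right _ _
          · obtain ⟨v, hv, hS⟩ := Finset.mem_biUnion.1 hS
            exact h𝓕2 v (Finset.mem_filter.1 hv).2 S hS
        · intro I hI hIG
          by_cases h : Disjoint S₀ I
          · exact ⟨S₀, Finset.mem_insert_self _ _, h⟩
          · obtain ⟨v, hv, hvI⟩ := Finset.not_disjoint_iff.1 h
            obtain ⟨S, hS, hd⟩ := h𝓕3 v (Finset.mem_filter.1 hv).2 I hI (fun e he => by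
              rw [hIG e he, zero_add]
              unfold weightLink
              split_ifs
              · rfl
              · by_contra hne
                exact hAne _ hne (hI _ (Finset.insert_subset hvI he)))
            exact ⟨S, Finset.mem_insert_of_mem (Finset.mem_biUnion.2 ⟨v, hv, hS⟩), hd⟩
    obtain ⟨𝓕, h1, h2, h3⟩ := key B (fun _ => 0) (fun _ => le_rfl) (by simp) (by simp)
      (fun J _ => by simp only [weightDegree, Finset.sum_const_zero]; positivity) (by
        simp only [Finset.sum_const_zero, zero_add]
        have h4 : c / 2 ^ (i + 2) ≤ c / 4 := by
          apply div_le_div_of_nonneg_left hc.le (by norm_num)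
          calc (4 : ℝ) = 2 ^ 2 := by norm_num
            _ ≤ 2 ^ (i + 2) := by gcongr <;> norm_num
        calc c / 2 ^ (i + 2) * Fintype.card V * q * D ≤ c / 4 * Fintype.card V * q * D := by
              gcongr
          _ ≤ c / 4 * (2 * q * Fintype.card V) * D := by
              have : 0 < c / 4 * Fintype.card V * q * D := by positivity
              linarith
          _ ≤ c / 4 * B * D := by gcongr
          _ = _ := by ring)
    exact ⟨𝓕, h1.trans (le_of_eq (by ring)), h2, fun I hI => h3 I hI fun _ _ => rfl⟩

/-- Hypergraph containers: every independent set lies in one of few sets of small weight. -/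
theorem exists_containers (l : ℕ) (c : ℝ) (hc : 0 < c) : ∃ r : ℕ,
    ∀ (V : Type) [Fintype V] [DecidableEq V] [Nonempty V] (w : Finset V → ℝ)
      (D q : ℝ) (B : ℕ), 0 < D → 0 < q → 2 * q * Fintype.card V ≤ B →
      (∀ e, 0 ≤ w e) → (∀ e, w e ≠ 0 → e.card = l) →
      (∀ J : Finset V, J.Nonempty → weightDegree w J ≤ q ^ (J.card - 1) * D) →
      ∃ 𝓒 : Finset (Finset V), 𝓒.card ≤ (Fintype.card V + 1) ^ (B * l * r) ∧
        (∀ C ∈ 𝓒, ∑ e with e ⊆ C, w e < c * Fintype.card V * D) ∧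
        ∀ I : Finset V, (∀ e ⊆ I, w e = 0) → ∃ C ∈ 𝓒, I ⊆ C := by
  obtain ⟨κ, hκ, hav⟩ := exists_avoided_sets l c hc
  obtain ⟨r, hr⟩ := exists_nat_gt (1 / κ)
  refine ⟨r, ?_⟩
  intro V _ _ _ w D q B hD hq hB hw hu hdeg
  have hN : (0 : ℝ) < Fintype.card V := by exact_mod_cast Fintype.card_pos
  have key : ∀ (s : ℕ) (C : Finset V), (C.card : ℝ) < s * (κ * Fintype.card V) →
      ∃ 𝓒 : Finset (Finset V), 𝓒.card ≤ ((Fintype.card V + 1) ^ (B * l)) ^ s ∧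
        (∀ C ∈ 𝓒, ∑ e with e ⊆ C, w e < c * Fintype.card V * D) ∧
        ∀ I : Finset V, I ⊆ C → (∀ e ⊆ I, w e = 0) → ∃ C ∈ 𝓒, I ⊆ C := by
    intro s
    induction s with
    | zero =>
      intro C hC
      simp only [Nat.cast_zero, zero_mul] at hC
      exact absurd hC (not_lt.2 (Nat.cast_nonneg _))
    | succ s ihs =>
      intro C hC
      by_cases hsmall : ∑ e with e ⊆ C, w e < c * Fintype.card V * D
      · exact ⟨{C}, by
          rw [Finset.card_singleton]
          exact Nat.one_le_pow _ _ (Nat.pow_pos (by omega)), by simpa using hsmall,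
          fun I hI _ => ⟨C, by simp, hI⟩⟩
      push Not at hsmall
      obtain ⟨𝓕, h1, h2, h3⟩ := hav V C (fun e => if e ⊆ C then w e else 0) D q B hD hq hB
        (fun e => by split_ifs; exacts [hw e, le_rfl])
        (fun e he => hu e fun h => he (by simp [h]))
        (fun e he => by by_contra h; exact he (by simp [h]))
        (fun J hJ => (weightDegree_mono (fun e => by split_ifs; exacts [le_rfl, hw e]) J).trans
          (hdeg J hJ))
        (by rwa [← Finset.sum_filter])
      have hrec : ∀ S ∈ 𝓕, ∃ 𝓒 : Finset (Finset V),
          𝓒.card ≤ ((Fintype.card V + 1) ^ (B * l)) ^ s ∧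
          (∀ C ∈ 𝓒, ∑ e with e ⊆ C, w e < c * Fintype.card V * D) ∧
          ∀ I : Finset V, I ⊆ C \ S → (∀ e ⊆ I, w e = 0) → ∃ C ∈ 𝓒, I ⊆ C := by
        intro S hS
        apply ihs
        obtain ⟨hSC, hScard⟩ := h2 S hS
        have := Finset.card_sdiff_add_card_eq_card hSC
        have h' : ((C \ S).card : ℝ) + S.card = C.card := by exact_mod_cast this
        push_cast at hC
        linarith
      choose! 𝓒 h𝓒1 h𝓒2 h𝓒3 using hrec
      refine ⟨𝓕.biUnion 𝓒, ?_, ?_, ?_⟩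
      · refine (Finset.card_biUnion_le_card_mul 𝓕 𝓒 _ h𝓒1).trans ?_
        rw [pow_succ _ s, mul_comm]
        exact Nat.mul_le_mul_left _ h1
      · intro C' hC'
        obtain ⟨S, hS, hC'⟩ := Finset.mem_biUnion.1 hC'
        exact h𝓒2 S hS C' hC'
      · intro I hIC hI
        obtain ⟨S, hS, hd⟩ := h3 I (fun e he => by simp [hI e he])
        obtain ⟨C', hC', hIC'⟩ := h𝓒3 S hS I (fun x hx => Finset.mem_sdiff.2
          ⟨hIC hx, fun hxS => Finset.disjoint_left.1 hd hxS hx⟩) hI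
        exact ⟨C', Finset.mem_biUnion.2 ⟨S, hS, hC'⟩, hIC'⟩
  obtain ⟨𝓒, h1, h2, h3⟩ := key r Finset.univ (by
    rw [Finset.card_univ]
    rw [div_lt_iff₀ hκ] at hr
    nlinarith)
  exact ⟨𝓒, by rwa [← pow_mul] at h1, h2, fun I hI => h3 I (Finset.subset_univ I) hI⟩

end Containers

/-- The random subset argument: some set meets all members of `𝓓` often and contains few members
of `𝓑`. -/
theorem exists_subset_of_expectation {V : Type} [Fintype V] [DecidableEq V] {p : ℝ} (hp0 : 0 ≤ p)
    (hp1 : p ≤ 1) (𝓓 𝓑 : Finset (Finset V)) {k : ℕ} (hk : 0 < k)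
    (h : ∑ D ∈ 𝓓, 2 ^ k * (1 - p / 2) ^ D.card + ∑ S ∈ 𝓑, p ^ S.card / k < 1) :
    ∃ G : Finset V, (∀ D ∈ 𝓓, k < (G ∩ D).card) ∧ (𝓑.filter fun S => S ⊆ G).card ≤ k := by
  set μ : Finset V → ℝ := fun G => (∏ _x ∈ G, p) * ∏ _x ∈ Finset.univ \ G, (1 - p) with hμ
  have hμ0 : ∀ G, 0 ≤ μ G := fun G => mul_nonneg (Finset.prod_nonneg fun _ _ => hp0)
    (Finset.prod_nonneg fun _ _ => sub_nonneg.2 hp1)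
  have hμ1 : ∑ G, μ G = 1 := by
    have := Finset.prod_add (fun _ : V => p) (fun _ => 1 - p) Finset.univ
    rw [Finset.powerset_univ] at this
    rw [hμ, ← this]
    simp
  have hμD : ∀ D : Finset V, ∑ G, μ G * (1 / 2) ^ (G ∩ D).card = (1 - p / 2) ^ D.card := by
    intro D
    have := Finset.prod_add (fun x : V => p * if x ∈ D then 1 / 2 else 1) (fun _ => 1 - p)
      Finset.univ
    rw [Finset.powerset_univ] at this
    have h2 : ∏ x : V, ((p * if x ∈ D then 1 / 2 else 1) + (1 - p)) = (1 - p / 2) ^ D.card := by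
      have : ∀ x : V, ((p * if x ∈ D then 1 / 2 else 1) + (1 - p))
          = if x ∈ D then 1 - p / 2 else 1 := fun x => by split_ifs <;> ring
      simp only [this]
      rw [Finset.prod_ite_mem, Finset.univ_inter, Finset.prod_const]
    rw [← h2, this]
    refine Finset.sum_congr rfl fun G _ => ?_
    rw [hμ, Finset.prod_mul_distrib, Finset.prod_ite_mem, Finset.prod_const ((1 : ℝ) / 2)]
    ring
  have hμS : ∀ S : Finset V, ∑ G, μ G * (if S ⊆ G then 1 else 0) = p ^ S.card := by
    intro S
    have := Finset.prod_add (fun x : V => p) (fun x => if x ∈ S then 0 else 1 - p) Finset.univ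
    rw [Finset.powerset_univ] at this
    have h2 : ∏ x : V, (p + if x ∈ S then 0 else 1 - p) = p ^ S.card := by
      have : ∀ x : V, (p + if x ∈ S then 0 else 1 - p) = if x ∈ S then p else 1 := fun x => by
        split_ifs <;> ring
      simp only [this]
      rw [Finset.prod_ite_mem, Finset.univ_inter, Finset.prod_const]
    rw [← h2, this]
    refine Finset.sum_congr rfl fun G _ => ?_
    rw [hμ, mul_assoc]
    congr 1
    split_ifs with hS
    · rw [mul_one]
      refine Finset.prod_congr rfl fun x hx => ?_
      rw [if_neg fun hxS => (Finset.mem_sdiff.1 hx).2 (hS hxS)]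
    · obtain ⟨x, hxS, hxG⟩ := Finset.not_subset.1 hS
      rw [mul_zero]
      symm
      exact Finset.prod_eq_zero (i := x) (Finset.mem_sdiff.2 ⟨Finset.mem_univ x, hxG⟩)
        (if_pos hxS)
  by_contra! hcon
  have hge : ∀ G : Finset V, 1 ≤ ∑ D ∈ 𝓓, (2 : ℝ) ^ k * (1 / 2) ^ (G ∩ D).card +
      ∑ S ∈ 𝓑, (if S ⊆ G then 1 else 0) / (k : ℝ) := by
    intro G
    have hk' : (0 : ℝ) < k := by exact_mod_cast hk
    by_cases hD : ∀ D ∈ 𝓓, k < (G ∩ D).card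
    · have h1 : 0 ≤ ∑ D ∈ 𝓓, (2 : ℝ) ^ k * (1 / 2) ^ (G ∩ D).card :=
        Finset.sum_nonneg fun _ _ => by positivity
      have h2 : (k : ℝ) ≤ (𝓑.filter fun S => S ⊆ G).card := by exact_mod_cast (hcon G hD).le
      rw [← Finset.sum_div, Finset.sum_boole]
      have := (one_le_div hk').2 h2
      linarith
    · push Not at hD
      obtain ⟨D, hD, hDk⟩ := hD
      have h1 : (1 : ℝ) ≤ 2 ^ k * (1 / 2) ^ (G ∩ D).card := by
        calc (1 : ℝ) = 2 ^ k * (1 / 2) ^ k := by rw [← mul_pow]; norm_num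
          _ ≤ _ := by
            gcongr 2 ^ k * ?_
            exact pow_le_pow_of_le_one (by norm_num) (by norm_num) hDk
      have h2 := Finset.single_le_sum
        (f := fun D => (2 : ℝ) ^ k * (1 / 2) ^ (G ∩ D).card) (fun _ _ => by positivity) hD
      have h3 : 0 ≤ ∑ S ∈ 𝓑, (if S ⊆ G then 1 else 0) / (k : ℝ) :=
        Finset.sum_nonneg fun _ _ => div_nonneg (by split_ifs <;> norm_num) hk'.le
      linarith
  have : ∑ G, μ G * 1 ≤ ∑ G, μ G * (∑ D ∈ 𝓓, (2 : ℝ) ^ k * (1 / 2) ^ (G ∩ D).card +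
      ∑ S ∈ 𝓑, (if S ⊆ G then 1 else 0) / (k : ℝ)) :=
    Finset.sum_le_sum fun G _ => mul_le_mul_of_nonneg_left (hge G) (hμ0 G)
  simp only [mul_one, hμ1, mul_add, Finset.sum_add_distrib, Finset.mul_sum] at this
  rw [Finset.sum_comm, Finset.sum_comm (t := 𝓑)] at this
  refine absurd h (not_lt.2 (this.trans (le_of_eq ?_)))
  congr 1
  · refine Finset.sum_congr rfl fun D _ => ?_
    rw [← hμD, Finset.mul_sum]
    exact Finset.sum_congr rfl fun G _ => by ring
  · refine Finset.sum_congr rfl fun S _ => ?_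
    rw [← hμS, Finset.sum_div]
    exact Finset.sum_congr rfl fun G _ => by ring

/-- The vertices covered by a set of edges. -/
def coveredVertices {W : Type} [DecidableEq W] (S : Finset (Sym2 W)) : Finset W :=
  S.biUnion Sym2.toFinset

/-- The slack of `S` in the density condition `b (e - 1) ≤ a (v - 2)`. -/
def densitySlack {W : Type} [DecidableEq W] (a b : ℕ) (S : Finset (Sym2 W)) : ℤ :=
  a * ((coveredVertices S).card - 2) - b * (S.card - 1)

section Density

variable {W : Type} [DecidableEq W]

lemma mem_coveredVertices {S : Finset (Sym2 W)} {x : W} :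
    x ∈ coveredVertices S ↔ ∃ e ∈ S, x ∈ e := by
  simp [coveredVertices]

lemma card_coveredVertices_le (S : Finset (Sym2 W)) :
    (coveredVertices S).card ≤ 2 * S.card := by
  rw [mul_comm]
  refine Finset.card_biUnion_le_card_mul _ _ _ fun e _ => ?_
  rw [Sym2.card_toFinset]
  split_ifs <;> norm_num

lemma two_le_card_coveredVertices {S : Finset (Sym2 W)} (hS : S.Nonempty)
    (hdiag : ∀ e ∈ S, ¬ e.IsDiag) : 2 ≤ (coveredVertices S).card := by
  obtain ⟨e, he⟩ := hS
  rw [← Sym2.card_toFinset_of_not_isDiag e (hdiag e he)]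
  exact Finset.card_le_card (Finset.subset_biUnion_of_mem Sym2.toFinset he)

lemma three_le_card_coveredVertices {S : Finset (Sym2 W)} (hS : 2 ≤ S.card)
    (hdiag : ∀ e ∈ S, ¬ e.IsDiag) : 3 ≤ (coveredVertices S).card := by
  obtain ⟨e, he, f, hf, hef⟩ := Finset.one_lt_card.1 hS
  by_contra! hlt
  have key : ∀ g ∈ S, g.toFinset = coveredVertices S := fun g hg =>
    Finset.eq_of_subset_of_card_le (Finset.subset_biUnion_of_mem Sym2.toFinset hg) (by
      rw [Sym2.card_toFinset_of_not_isDiag g (hdiag g hg)]; omega)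
  refine hef (Sym2.ext fun x => ?_)
  rw [← Sym2.mem_toFinset, ← Sym2.mem_toFinset, key e he, key f hf]

lemma densitySlack_union_add_inter_le (a b : ℕ) (S T : Finset (Sym2 W)) :
    densitySlack a b (S ∪ T) + densitySlack a b (S ∩ T) ≤
      densitySlack a b S + densitySlack a b T := by
  have h1 : ((S ∪ T).card : ℤ) + (S ∩ T).card = S.card + T.card := by
    exact_mod_cast Finset.card_union_add_card_inter S T
  have h2 : coveredVertices (S ∪ T) = coveredVertices S ∪ coveredVertices T :=
    Finset.union_biUnion
  have h3 : coveredVertices (S ∩ T) ⊆ coveredVertices S ∩ coveredVertices T := fun x hx => by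
    obtain ⟨e, he, hx⟩ := mem_coveredVertices.1 hx
    exact Finset.mem_inter.2 ⟨mem_coveredVertices.2 ⟨e, (Finset.mem_inter.1 he).1, hx⟩,
      mem_coveredVertices.2 ⟨e, (Finset.mem_inter.1 he).2, hx⟩⟩
  have h4 : ((coveredVertices (S ∪ T)).card : ℤ) + (coveredVertices (S ∩ T)).card ≤
      (coveredVertices S).card + (coveredVertices T).card := by
    rw [h2]
    have h5 := Finset.card_le_card h3
    have h6 := Finset.card_union_add_card_inter (coveredVertices S) (coveredVertices T)
    omega
  simp only [densitySlack]
  have ha : (0 : ℤ) ≤ a := Int.natCast_nonneg a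
  nlinarith

/-- If all edge sets inside `H` are sparse, then `H` can be split without leaving a member of a
family of tight strictly balanced sets in one part. -/
theorem exists_splitting (a b : ℕ) (𝓧 : Set (Finset (Sym2 W)))
    (hcard : ∀ X ∈ 𝓧, 3 ≤ X.card) (htight : ∀ X ∈ 𝓧, densitySlack a b X = 0)
    (hbal : ∀ X ∈ 𝓧, ∀ Y ⊂ X, 2 ≤ Y.card → 0 < densitySlack a b Y) (H : Finset (Sym2 W))
    (hH : ∀ S ⊆ H, S.Nonempty → 0 ≤ densitySlack a b S) :
    ∃ R ⊆ H, ∀ X ∈ 𝓧, ¬ X ⊆ R ∧ ¬ X ⊆ H \ R := by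
  classical
  induction H using Finset.strongInduction with
  | H H ih =>
  by_cases hX₀ : ∃ X ∈ 𝓧, X ⊆ H
  swap
  · push Not at hX₀
    refine ⟨∅, Finset.empty_subset _,
      fun X hX => ⟨fun h => ?_, fun h => hX₀ X hX (by simpa using h)⟩⟩
    have h1 := Finset.card_le_card h
    have h2 := hcard X hX
    rw [Finset.card_empty] at h1
    omega
  obtain ⟨X₀, hX₀, hX₀H⟩ := hX₀
  have heq : ∀ X ∈ 𝓧, ∀ Y ∈ 𝓧, Y ⊆ X → Y = X := fun X hX Y hY hYX => by
    by_contra hne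
    have h1 := hbal X hX Y (hYX.ssubset_of_ne hne) (by have := hcard Y hY; omega)
    rw [htight Y hY] at h1
    exact lt_irrefl _ h1
  set good : Finset (Sym2 W) → Prop := fun S => S.Nonempty ∧ densitySlack a b S = 0 ∧
    ∃ R ⊆ S, ∀ X ∈ 𝓧, ¬ X ⊆ R ∧ ¬ X ⊆ S \ R with hgood
  have hgood₀ : good X₀ := by
    have h3 := hcard X₀ hX₀
    have hne : X₀.Nonempty := Finset.card_pos.1 (by omega)
    obtain ⟨e, he⟩ := hne
    refine ⟨⟨e, he⟩, htight X₀ hX₀, {e}, by simpa using he, fun X hX => ⟨fun h => ?_, fun h => ?_⟩⟩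
    · have h1 := Finset.card_le_card h
      have h2 := hcard X hX
      rw [Finset.card_singleton] at h1; omega
    · have h1 := heq X₀ hX₀ X hX (h.trans Finset.sdiff_subset)
      rw [h1] at h
      have := h he
      simp at this
  obtain ⟨S, hS, hSmax⟩ := Finset.exists_max_image (H.powerset.filter good) Finset.card
    ⟨X₀, Finset.mem_filter.2 ⟨Finset.mem_powerset.2 hX₀H, hgood₀⟩⟩
  obtain ⟨hSH, hSne, hS0, R, hRS, hR⟩ : S ⊆ H ∧ good S := by simpa using hS
  have attach : ∀ T ⊆ H, densitySlack a b T = 0 → ∀ X ∈ 𝓧, X ⊆ H → (T ∩ X).Nonempty → ¬ X ⊆ T →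
      (T ∩ X).card = 1 ∧ densitySlack a b (T ∪ X) = 0 := by
    intro T hT hT0 X hX hXH hne hXT
    have h1 := densitySlack_union_add_inter_le a b T X
    rw [hT0, htight X hX] at h1
    have h2 := hH (T ∪ X) (Finset.union_subset hT hXH) (hne.mono (fun x hx =>
      Finset.mem_union_left _ (Finset.mem_inter.1 hx).1))
    have h3 := hH (T ∩ X) (Finset.inter_subset_left.trans hT) hne
    have h4 : (T ∩ X).card < 2 := by
      by_contra! h4
      have := hbal X hX (T ∩ X) (Finset.inter_subset_right.ssubset_of_ne fun h =>
        hXT (Finset.inter_eq_right.1 h)) h4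
      omega
    have := hne.card_pos
    constructor <;> omega
  have closed : ∀ X ∈ 𝓧, X ⊆ H → (S ∩ X).Nonempty → X ⊆ S := by
    intro X hX hXH hne
    by_contra hXS
    obtain ⟨h1, h2⟩ := attach S hSH hS0 X hX hXH hne hXS
    have h3 : 1 < (X \ S).card := by
      have := Finset.card_sdiff_add_card_inter X S
      rw [Finset.inter_comm] at this
      have := hcard X hX
      omega
    obtain ⟨x, hx, y, hy, hxy⟩ := Finset.one_lt_card.1 h3
    rw [Finset.mem_sdiff] at hx hy
    have hlocal : ∀ Y ∈ 𝓧, Y ⊆ S ∪ X → Y ⊆ S ∨ Y = X := by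
      intro Y hY hYSX
      by_contra! hcon
      have hYX : ¬ Y ⊆ X := fun h => hcon.2 (heq X hX Y hY h)
      have hYH : Y ⊆ H := hYSX.trans (Finset.union_subset hSH hXH)
      have e1 : (S ∩ Y).Nonempty := by
        obtain ⟨z, hz, hzX⟩ := Finset.not_subset.1 hYX
        exact ⟨z, Finset.mem_inter.2 ⟨(Finset.mem_union.1 (hYSX hz)).resolve_right hzX, hz⟩⟩
      have e2 : (X ∩ Y).Nonempty := by
        obtain ⟨z, hz, hzS⟩ := Finset.not_subset.1 hcon.1
        exact ⟨z, Finset.mem_inter.2 ⟨(Finset.mem_union.1 (hYSX hz)).resolve_left hzS, hz⟩⟩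
      have c1 := (attach S hSH hS0 Y hY hYH e1 hcon.1).1
      have c2 := (attach X hXH (htight X hX) Y hY hYH e2 hYX).1
      have c3 : Y ⊆ (S ∩ Y) ∪ (X ∩ Y) := fun z hz => by
        rw [← Finset.union_inter_distrib_right]
        exact Finset.mem_inter.2 ⟨hYSX hz, hz⟩
      have c4 := (Finset.card_le_card c3).trans (Finset.card_union_le _ _)
      have := hcard Y hY
      omega
    have hbig : good (S ∪ X) := by
      refine ⟨hSne.mono Finset.subset_union_left, h2, insert x R,
        Finset.insert_subset (Finset.mem_union_right _ hx.1)
          (hRS.trans Finset.subset_union_left), fun Y hY => ⟨fun h => ?_, fun h => ?_⟩⟩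
      · rcases hlocal Y hY (h.trans (Finset.insert_subset (Finset.mem_union_right _ hx.1)
          (hRS.trans Finset.subset_union_left))) with hYS | rfl
        · refine (hR Y hY).1 fun z hz => (Finset.mem_insert.1 (h hz)).resolve_left ?_
          rintro rfl; exact hx.2 (hYS hz)
        · rcases Finset.mem_insert.1 (h hy.1) with h | h
          · exact hxy h.symm
          · exact hy.2 (hRS h)
      · rcases hlocal Y hY (h.trans Finset.sdiff_subset) with hYS | rfl
        · refine (hR Y hY).2 fun z hz => Finset.mem_sdiff.2 ⟨hYS hz, fun hzR => ?_⟩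
          exact (Finset.mem_sdiff.1 (h hz)).2 (Finset.mem_insert_of_mem hzR)
        · exact (Finset.mem_sdiff.1 (h hx.1)).2 (Finset.mem_insert_self _ _)
    have hmax := hSmax (S ∪ X) (Finset.mem_filter.2
      ⟨Finset.mem_powerset.2 (Finset.union_subset hSH hXH), hbig⟩)
    have : S ⊂ S ∪ X := Finset.subset_union_left.ssubset_of_ne fun h =>
      hXS (h ▸ Finset.subset_union_right)
    exact absurd (Finset.card_lt_card this) (not_lt.2 hmax)
  obtain ⟨R', hR'H, hR'⟩ := ih (H \ S) (Finset.sdiff_ssubset hSH hSne)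
    fun T hT => hH T (hT.trans Finset.sdiff_subset)
  refine ⟨R ∪ R', Finset.union_subset (hRS.trans hSH) (hR'H.trans Finset.sdiff_subset),
    fun X hX => ⟨fun h => ?_, fun h => ?_⟩⟩
  · by_cases hne : (S ∩ X).Nonempty
    · have hXS := closed X hX (h.trans (Finset.union_subset (hRS.trans hSH)
        (hR'H.trans Finset.sdiff_subset))) hne
      refine (hR X hX).1 fun z hz => (Finset.mem_union.1 (h hz)).resolve_right fun hz' => ?_
      exact (Finset.mem_sdiff.1 (hR'H hz')).2 (hXS hz)
    · refine (hR' X hX).1 fun z hz => (Finset.mem_union.1 (h hz)).resolve_left fun hz' => ?_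
      exact hne ⟨z, Finset.mem_inter.2 ⟨hRS hz', hz⟩⟩
  · by_cases hne : (S ∩ X).Nonempty
    · have hXS := closed X hX (h.trans Finset.sdiff_subset) hne
      refine (hR X hX).2 fun z hz => Finset.mem_sdiff.2 ⟨hXS hz, fun hz' => ?_⟩
      exact (Finset.mem_sdiff.1 (h hz)).2 (Finset.mem_union_left _ hz')
    · refine (hR' X hX).2 fun z hz => Finset.mem_sdiff.2 ⟨Finset.mem_sdiff.2
        ⟨(Finset.mem_sdiff.1 (h hz)).1, fun hz' => hne ⟨z, Finset.mem_inter.2 ⟨hz', hz⟩⟩⟩,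
        fun hz' => ?_⟩
      exact (Finset.mem_sdiff.1 (h hz)).2 (Finset.mem_union_right _ hz')

lemma coveredVertices_image {α : Type} [DecidableEq α] (f : α → W) (S : Finset (Sym2 α)) :
    coveredVertices (S.image (Sym2.map f)) = (coveredVertices S).image f := by
  ext x
  simp only [mem_coveredVertices, Finset.mem_image, exists_exists_and_eq_and, Sym2.mem_map]
  constructor
  · rintro ⟨e, he, y, hy, rfl⟩; exact ⟨y, ⟨e, he, hy⟩, rfl⟩
  · rintro ⟨y, ⟨e, he, hy⟩, rfl⟩; exact ⟨e, he, y, hy, rfl⟩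

lemma densitySlack_image {α : Type} [DecidableEq α] (a b : ℕ) {f : α → W}
    (hf : Function.Injective f) (S : Finset (Sym2 α)) :
    densitySlack a b (S.image (Sym2.map f)) = densitySlack a b S := by
  rw [densitySlack, coveredVertices_image, Finset.card_image_of_injective _ hf,
    Finset.card_image_of_injective _ (Sym2.map.injective hf), densitySlack]

end Density

/-- The Ramsey theorem for two colours. -/
theorem exists_ramsey_number (s t : ℕ) : ∃ R : ℕ, ∀ {W : Type} (c : Sym2 W → Prop) (X : Finset W),
    R ≤ X.card → (∃ S ⊆ X, S.card = s ∧ ∀ x ∈ S, ∀ y ∈ S, x ≠ y → c s(x, y)) ∨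
      ∃ S ⊆ X, S.card = t ∧ ∀ x ∈ S, ∀ y ∈ S, x ≠ y → ¬ c s(x, y) := by
  classical
  induction s generalizing t with
  | zero => exact ⟨0, fun c X _ => Or.inl ⟨∅, by simp⟩⟩
  | succ s ihs =>
    induction t with
    | zero => exact ⟨0, fun c X _ => Or.inr ⟨∅, by simp⟩⟩
    | succ t iht =>
      obtain ⟨R₁, hR₁⟩ := ihs (t + 1)
      obtain ⟨R₂, hR₂⟩ := iht
      refine ⟨R₁ + R₂ + 1, fun {W} c X hX => ?_⟩
      obtain ⟨x, hx⟩ : X.Nonempty := Finset.card_pos.1 (by omega)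
      set Y := X.erase x with hY
      have hYX : Y ⊆ X := Finset.erase_subset x X
      have hxY : x ∉ Y := Finset.notMem_erase x X
      have hYcard : Y.card = X.card - 1 := Finset.card_erase_of_mem hx
      have hsplit := Finset.card_filter_add_card_filter_not (s := Y) fun y => c s(x, y)
      by_cases h : R₁ ≤ (Y.filter fun y => c s(x, y)).card
      · rcases hR₁ c _ h with ⟨S, hS, hcard, hc⟩ | ⟨S, hS, hcard, hc⟩
        · left
          have hxS : x ∉ S := fun h => hxY (Finset.mem_filter.1 (hS h)).1
          refine ⟨insert x S, Finset.insert_subset hx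
            ((hS.trans (Finset.filter_subset _ _)).trans hYX),
            by rw [Finset.card_insert_of_notMem hxS, hcard], ?_⟩
          intro y hy z hz hyz
          rcases Finset.mem_insert.1 hy with rfl | hy' <;>
            rcases Finset.mem_insert.1 hz with rfl | hz'
          · exact absurd rfl hyz
          · exact (Finset.mem_filter.1 (hS hz')).2
          · rw [Sym2.eq_swap]; exact (Finset.mem_filter.1 (hS hy')).2
          · exact hc y hy' z hz' hyz
        · exact Or.inr ⟨S, (hS.trans (Finset.filter_subset _ _)).trans hYX, hcard, hc⟩
      · rcases hR₂ c (Y.filter fun y => ¬ c s(x, y)) (by omega) with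
          ⟨S, hS, hcard, hc⟩ | ⟨S, hS, hcard, hc⟩
        · exact Or.inl ⟨S, (hS.trans (Finset.filter_subset _ _)).trans hYX, hcard, hc⟩
        · right
          have hxS : x ∉ S := fun h => hxY (Finset.mem_filter.1 (hS h)).1
          refine ⟨insert x S, Finset.insert_subset hx
            ((hS.trans (Finset.filter_subset _ _)).trans hYX),
            by rw [Finset.card_insert_of_notMem hxS, hcard], ?_⟩
          intro y hy z hz hyz
          rcases Finset.mem_insert.1 hy with rfl | hy' <;>
            rcases Finset.mem_insert.1 hz with rfl | hz'
          · exact absurd rfl hyz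
          · exact (Finset.mem_filter.1 (hS hz')).2
          · rw [Sym2.eq_swap]; exact (Finset.mem_filter.1 (hS hy')).2
          · exact hc y hy' z hz' hyz

/-- The number of functions with prescribed restrictions along an injection. -/
lemma card_comp_mem_le {α β W : Type} [Fintype α] [DecidableEq α] [Fintype β] [DecidableEq β]
    [Fintype W] [DecidableEq W] {g : α → β} (hg : Function.Injective g) (𝓐 : Finset (α → W)) :
    (Finset.univ.filter fun ψ : β → W => ψ ∘ g ∈ 𝓐).card ≤
      𝓐.card * Fintype.card W ^ (Fintype.card β - Fintype.card α) := by
  classical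
  have hcard : Fintype.card {x // x ∉ Set.range g} = Fintype.card β - Fintype.card α := by
    rw [Fintype.card_subtype_compl]
    congr 1
    exact Set.card_range_of_injective hg
  rw [← hcard, ← Fintype.card_fun, ← Finset.card_univ, ← Finset.card_product]
  refine Finset.card_le_card_of_injOn (fun ψ => (ψ ∘ g, fun x => ψ x.1)) ?_ ?_
  · intro ψ hψ
    simpa using hψ
  · intro ψ _ ψ' _ h
    simp only [Prod.mk.injEq] at h
    funext x
    by_cases hx : x ∈ Set.range g
    · obtain ⟨y, rfl⟩ := hx
      exact congrFun h.1 y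
    · exact congrFun h.2 ⟨x, hx⟩

/-- The embeddings of the edge set `T` into the edge set `C`. -/
def embeddingsInto {α W : Type} [Fintype α] [DecidableEq α] [Fintype W] [DecidableEq W]
    (T : Finset (Sym2 α)) (C : Finset (Sym2 W)) : Finset (α → W) :=
  Finset.univ.filter fun f => Function.Injective f ∧ T.image (Sym2.map f) ⊆ C

/-- Supersaturated Ramsey theorem. -/
theorem exists_many_embeddings {α : Type} [Fintype α] [DecidableEq α] (T : Finset (Sym2 α))
    (hT : ∀ e ∈ T, ¬ e.IsDiag) : ∃ γ δ : ℝ, 0 < γ ∧ 0 < δ ∧ ∃ n₀ : ℕ, ∀ n ≥ n₀,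
      ∀ C₁ C₂ : Finset (Sym2 (Fin n)), ((C₁ ∪ C₂)ᶜ.card : ℝ) ≤ δ * n ^ 2 →
        γ * n ^ Fintype.card α ≤ (embeddingsInto T C₁).card ∨
        γ * n ^ Fintype.card α ≤ (embeddingsInto T C₂).card := by
  classical
  obtain ⟨R₀, hR₀⟩ := exists_ramsey_number (Fintype.card α) (Fintype.card α)
  set v := Fintype.card α with hv
  set R := R₀ + v + 2 with hR
  have hRpos : (0 : ℝ) < R := by positivity
  refine ⟨1 / (4 * R ^ v), 1 / (8 * R ^ 2), by positivity, by positivity, 8 * R ^ 2, ?_⟩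
  intro n hn C₁ C₂ hD
  have hnR : (8 * R ^ 2 : ℝ) ≤ n := by exact_mod_cast hn
  have hnpos : (0 : ℝ) < n := by
    have : (0 : ℝ) < 8 * R ^ 2 := by positivity
    linarith
  set D : Finset (Sym2 (Fin n)) := (C₁ ∪ C₂)ᶜ ∪ Finset.univ.image (fun x => s(x, x)) with hDdef
  have hDcard : (D.card : ℝ) ≤ 1 / (8 * R ^ 2) * n ^ 2 + n := by
    have h1 : D.card ≤ (C₁ ∪ C₂)ᶜ.card + n := by
      refine (Finset.card_union_le _ _).trans (Nat.add_le_add_left ?_ _)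
      exact Finset.card_image_le.trans (by simp)
    have h2 : (D.card : ℝ) ≤ ((C₁ ∪ C₂)ᶜ.card : ℝ) + n := by exact_mod_cast h1
    linarith
  set 𝓐 : Finset (Fin 2 → Fin n) := Finset.univ.filter fun h => s(h 0, h 1) ∈ D with h𝓐
  have h𝓐card : 𝓐.card ≤ 2 * D.card := by
    refine Finset.card_le_mul_card_image_of_maps_to (f := fun h : Fin 2 → Fin n => s(h 0, h 1))
      (fun h hh => (Finset.mem_filter.1 hh).2) 2 fun e _ => ?_
    induction e with
    | h x y =>
      refine (Finset.card_le_card (t := {![x, y], ![y, x]}) fun h hh => ?_).trans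
        Finset.card_le_two
      have := (Finset.mem_filter.1 hh).2
      rw [Sym2.eq_iff] at this
      rw [Finset.mem_insert, Finset.mem_singleton]
      rcases this with ⟨h1, h2⟩ | ⟨h1, h2⟩
      · left; funext i; fin_cases i <;> simp [h1, h2]
      · right; funext i; fin_cases i <;> simp [h1, h2]
  set bad : Finset (Fin R → Fin n) := Finset.univ.filter fun ψ =>
    ∃ i j, i ≠ j ∧ s(ψ i, ψ j) ∈ D with hbad
  have hbadcard : bad.card ≤ R ^ 2 * (2 * D.card * n ^ (R - 2)) := by
    have h1 : bad ⊆ (Finset.univ.filter fun ij : Fin R × Fin R => ij.1 ≠ ij.2).biUnion fun ij =>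
        Finset.univ.filter fun ψ : Fin R → Fin n => ψ ∘ ![ij.1, ij.2] ∈ 𝓐 := by
      intro ψ hψ
      obtain ⟨i, j, hij, h⟩ := (Finset.mem_filter.1 hψ).2
      refine Finset.mem_biUnion.2 ⟨(i, j), by simpa using hij, ?_⟩
      simpa [h𝓐] using h
    refine (Finset.card_le_card h1).trans ((Finset.card_biUnion_le_card_mul _ _
      (2 * D.card * n ^ (R - 2)) fun ij hij => ?_).trans (Nat.mul_le_mul_right _ ?_))
    · have hij := (Finset.mem_filter.1 hij).2
      have hinj : Function.Injective ![ij.1, ij.2] := by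
        intro a b hab
        fin_cases a <;> fin_cases b <;> simp_all
      refine (card_comp_mem_le hinj 𝓐).trans ?_
      simp only [Fintype.card_fin]
      exact Nat.mul_le_mul_right _ h𝓐card
    · refine (Finset.card_le_univ _).trans (le_of_eq ?_)
      simp [sq]
  have hgood : badᶜ ⊆ (Finset.univ : Finset (α → Fin R)).biUnion fun χ =>
      if Function.Injective χ then Finset.univ.filter fun ψ : Fin R → Fin n =>
        ψ ∘ χ ∈ embeddingsInto T C₁ ∪ embeddingsInto T C₂ else ∅ := by
    intro ψ hψ
    have hψ' : ∀ i j, i ≠ j → s(ψ i, ψ j) ∉ D := by simpa [hbad] using hψ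
    have hψinj : Function.Injective ψ := fun i j hij => by
      by_contra hne
      apply hψ' i j hne
      rw [hij]
      exact Finset.mem_union_right _ (Finset.mem_image_of_mem _ (Finset.mem_univ _))
    have hcov : ∀ i j, i ≠ j → s(ψ i, ψ j) ∈ C₁ ∪ C₂ := fun i j hij => by
      by_contra h
      exact hψ' i j hij (Finset.mem_union_left _ (Finset.mem_compl.2 h))
    have hemb : ∀ S : Finset (Fin R), S.card = v → ∃ χ : α → Fin R, Function.Injective χ ∧
        ∀ x, χ x ∈ S := by
      intro S hS
      have e : α ≃ S := Fintype.equivOfCardEq (by rw [Fintype.card_coe, hS])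
      exact ⟨fun x => (e x).1, Subtype.val_injective.comp e.injective, fun x => (e x).2⟩
    rcases hR₀ (fun e => Sym2.map ψ e ∈ C₁) Finset.univ (by simp [hR]; omega) with
      ⟨S, -, hcard, hc⟩ | ⟨S, -, hcard, hc⟩
    · obtain ⟨χ, hχ, hχS⟩ := hemb S hcard
      refine Finset.mem_biUnion.2 ⟨χ, Finset.mem_univ _, ?_⟩
      rw [if_pos hχ]
      refine Finset.mem_filter.2 ⟨Finset.mem_univ _, Finset.mem_union_left _ ?_⟩
      refine Finset.mem_filter.2 ⟨Finset.mem_univ _, hψinj.comp hχ, ?_⟩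
      intro e he
      obtain ⟨e', he', rfl⟩ := Finset.mem_image.1 he
      have hnd := hT e' he'
      induction e' with
      | h x y => exact hc _ (hχS x) _ (hχS y) fun h => hnd (hχ h)
    · obtain ⟨χ, hχ, hχS⟩ := hemb S hcard
      refine Finset.mem_biUnion.2 ⟨χ, Finset.mem_univ _, ?_⟩
      rw [if_pos hχ]
      refine Finset.mem_filter.2 ⟨Finset.mem_univ _, Finset.mem_union_right _ ?_⟩
      refine Finset.mem_filter.2 ⟨Finset.mem_univ _, hψinj.comp hχ, ?_⟩
      intro e he
      obtain ⟨e', he', rfl⟩ := Finset.mem_image.1 he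
      have hnd := hT e' he'
      induction e' with
      | h x y =>
        have hne : χ x ≠ χ y := fun h => hnd (hχ h)
        exact (Finset.mem_union.1 (hcov _ _ hne)).resolve_left
          (hc _ (hχS x) _ (hχS y) hne)
  set c₁ := (embeddingsInto T C₁).card with hc₁
  set c₂ := (embeddingsInto T C₂).card with hc₂
  have hgoodcard : badᶜ.card ≤ R ^ v * ((c₁ + c₂) * n ^ (R - v)) := by
    refine (Finset.card_le_card hgood).trans ((Finset.card_biUnion_le_card_mul _ _
      ((c₁ + c₂) * n ^ (R - v)) fun χ _ => ?_).trans (Nat.mul_le_mul_right _ ?_))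
    · split_ifs with hχ
      · refine (card_comp_mem_le hχ _).trans ?_
        simp only [Fintype.card_fin]
        exact Nat.mul_le_mul_right _ (Finset.card_union_le _ _)
      · simp
    · simp [hv]
  have htotal : bad.card + badᶜ.card = n ^ R := by
    rw [Finset.card_add_card_compl]; simp
  have htotal' : (bad.card : ℝ) + badᶜ.card = n ^ R := by exact_mod_cast htotal
  have hbad' : (bad.card : ℝ) ≤ n ^ R / 2 := by
    calc (bad.card : ℝ) ≤ R ^ 2 * (2 * D.card * n ^ (R - 2)) := by exact_mod_cast hbadcard
      _ ≤ R ^ 2 * (2 * (1 / (8 * R ^ 2) * n ^ 2 + n) * n ^ (R - 2)) := by gcongr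
      _ = (1 / 4 * n ^ 2 + 2 * R ^ 2 * n) * n ^ (R - 2) := by field_simp; ring
      _ ≤ (1 / 2 * n ^ 2) * n ^ (R - 2) := by
        gcongr
        nlinarith
      _ = n ^ R / 2 := by
        have : R = 2 + (R - 2) := by omega
        conv_rhs => rw [this, pow_add]
        ring
  have hgood' : (badᶜ.card : ℝ) ≤ R ^ v * ((c₁ + c₂) * n ^ (R - v)) := by
    exact_mod_cast hgoodcard
  have hpow : (n : ℝ) ^ R = n ^ v * n ^ (R - v) := by
    rw [← pow_add]; congr 1; omega
  have hfinal : (n : ℝ) ^ v ≤ 2 * R ^ v * (c₁ + c₂) := by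
    have h1 : (0 : ℝ) < n ^ (R - v) := by positivity
    refine le_of_mul_le_mul_right ?_ h1
    rw [← hpow]
    nlinarith
  have h4 : (0 : ℝ) < 4 * R ^ v := by positivity
  by_contra! hcon
  rw [div_mul_eq_mul_div, one_mul, lt_div_iff₀ h4, lt_div_iff₀ h4] at hcon
  nlinarith [hcon.1, hcon.2]

/-- The number of embeddings of the edge set `T` with image `e`. -/
def copyWeight {α W : Type} [Fintype α] [DecidableEq α] [Fintype W] [DecidableEq W]
    (T : Finset (Sym2 α)) (e : Finset (Sym2 W)) : ℝ :=
  ((Finset.univ.filter fun f : α → W =>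
    Function.Injective f ∧ T.image (Sym2.map f) = e).card : ℝ)

section Copies

variable {α W : Type} [Fintype α] [DecidableEq α] [Fintype W] [DecidableEq W]

lemma sum_copyWeight (T : Finset (Sym2 α)) (P : Finset (Sym2 W) → Prop) [DecidablePred P] :
    ∑ e with P e, copyWeight T e = ((Finset.univ.filter fun f : α → W =>
      Function.Injective f ∧ P (T.image (Sym2.map f))).card : ℝ) := by
  rw [Finset.card_eq_sum_card_fiberwise (f := fun f : α → W => T.image (Sym2.map f))
    (t := Finset.univ.filter P)]
  · push_cast
    refine Finset.sum_congr rfl fun e he => ?_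
    rw [copyWeight, Finset.filter_filter]
    congr 2
    ext f
    simp only [Finset.mem_filter, Finset.mem_univ, true_and]
    constructor
    · rintro ⟨h1, rfl⟩; exact ⟨⟨h1, (Finset.mem_filter.1 he).2⟩, rfl⟩
    · rintro ⟨⟨h1, -⟩, h2⟩; exact ⟨h1, h2⟩
  · intro f hf
    simpa using (Finset.mem_filter.1 hf).2.2

lemma card_embeddings_onto_le (S : Finset (Sym2 α)) (J : Finset (Sym2 W)) :
    (Finset.univ.filter fun f : α → W =>
      Function.Injective f ∧ S.image (Sym2.map f) = J).card ≤
      Fintype.card α ^ Fintype.card α *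
        Fintype.card W ^ (Fintype.card α - (coveredVertices S).card) := by
  classical
  rcases Finset.eq_empty_or_nonempty (Finset.univ.filter fun f : α → W =>
      Function.Injective f ∧ S.image (Sym2.map f) = J) with h | ⟨f₀, hf₀⟩
  · rw [h]; simp
  obtain ⟨hinj, hf₀⟩ := (Finset.mem_filter.1 hf₀).2
  have hcard : (coveredVertices J).card = (coveredVertices S).card := by
    rw [← hf₀, coveredVertices_image, Finset.card_image_of_injective _ hinj]
  have hle : (coveredVertices S).card ≤ Fintype.card α := Finset.card_le_univ _
  have h1 : (Finset.univ.filter fun f : α → W =>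
      Function.Injective f ∧ S.image (Sym2.map f) = J) ⊆
      Finset.univ.filter fun f : α → W => f ∘ (Subtype.val : coveredVertices S → α) ∈
        Fintype.piFinset fun _ : coveredVertices S => coveredVertices J := by
    intro f hf
    obtain ⟨-, hf⟩ := (Finset.mem_filter.1 hf).2
    refine Finset.mem_filter.2 ⟨Finset.mem_univ _, Fintype.mem_piFinset.2 fun x => ?_⟩
    rw [← hf, coveredVertices_image]
    exact Finset.mem_image_of_mem f x.2
  refine (Finset.card_le_card h1).trans
    ((card_comp_mem_le Subtype.val_injective _).trans ?_)
  rw [Fintype.card_piFinset, Finset.prod_const, Finset.card_univ, Fintype.card_coe, hcard]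
  refine Nat.mul_le_mul_right _ ?_
  rcases Nat.eq_zero_or_pos (Fintype.card α) with h | h
  · have : (coveredVertices S).card = 0 := by omega
    rw [this, h]
  · exact (Nat.pow_le_pow_left hle _).trans (Nat.pow_le_pow_right h hle)

lemma weightDegree_copyWeight_le (T : Finset (Sym2 α)) {q : ℝ} (hq0 : 0 ≤ q)
    (hq : ∀ S ⊆ T, S.Nonempty →
      (Fintype.card W : ℝ) ^ (Fintype.card α - (coveredVertices S).card) ≤
        q ^ (S.card - 1) * (Fintype.card W : ℝ) ^ (Fintype.card α - 2))
    {J : Finset (Sym2 W)} (hJ : J.Nonempty) :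
    weightDegree (copyWeight T) J ≤ q ^ (J.card - 1) *
      (2 ^ T.card * (Fintype.card α : ℝ) ^ Fintype.card α *
        (Fintype.card W : ℝ) ^ (Fintype.card α - 2)) := by
  classical
  rw [weightDegree, sum_copyWeight]
  set v := Fintype.card α
  set n := Fintype.card W
  have h1 : (Finset.univ.filter fun f : α → W => Function.Injective f ∧
      J ⊆ T.image (Sym2.map f)) ⊆ (T.powerset.filter fun S => S.card = J.card).biUnion
        fun S => Finset.univ.filter fun f : α → W =>
          Function.Injective f ∧ S.image (Sym2.map f) = J := by
    intro f hf
    obtain ⟨hinj, hf⟩ := (Finset.mem_filter.1 hf).2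
    obtain ⟨S, hS, hSJ⟩ := Finset.subset_image_iff.1 hf
    refine Finset.mem_biUnion.2 ⟨S, Finset.mem_filter.2 ⟨Finset.mem_powerset.2 hS, ?_⟩,
      Finset.mem_filter.2 ⟨Finset.mem_univ _, hinj, hSJ⟩⟩
    rw [← hSJ, Finset.card_image_of_injective _ (Sym2.map.injective hinj)]
  have hnonneg : ∀ S ⊆ T, S.card = J.card →
      (v : ℝ) ^ v * (n : ℝ) ^ (v - (coveredVertices S).card) ≤
        (v : ℝ) ^ v * (q ^ (J.card - 1) * (n : ℝ) ^ (v - 2)) := fun S hS hSJ => by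
    have := hq S hS (Finset.card_pos.1 (hSJ ▸ hJ.card_pos))
    rw [hSJ] at this
    gcongr
  calc ((Finset.univ.filter fun f : α → W => Function.Injective f ∧
      J ⊆ T.image (Sym2.map f)).card : ℝ)
      ≤ ∑ S ∈ T.powerset.filter fun S => S.card = J.card,
        ((Finset.univ.filter fun f : α → W =>
          Function.Injective f ∧ S.image (Sym2.map f) = J).card : ℝ) := by
        exact_mod_cast (Finset.card_le_card h1).trans Finset.card_biUnion_le
    _ ≤ ∑ S ∈ T.powerset.filter fun S => S.card = J.card,
        (v : ℝ) ^ v * (q ^ (J.card - 1) * (n : ℝ) ^ (v - 2)) := by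
        refine Finset.sum_le_sum fun S hS => ?_
        obtain ⟨hS, hSJ⟩ := Finset.mem_filter.1 hS
        refine le_trans ?_ (hnonneg S (Finset.mem_powerset.1 hS) hSJ)
        exact_mod_cast card_embeddings_onto_le S J
    _ ≤ 2 ^ T.card * ((v : ℝ) ^ v * (q ^ (J.card - 1) * (n : ℝ) ^ (v - 2))) := by
        rw [Finset.sum_const, nsmul_eq_mul]
        have h2 : ((T.powerset.filter fun S => S.card = J.card).card : ℝ) ≤ 2 ^ T.card := by
          exact_mod_cast (Finset.card_filter_le _ _).trans (Finset.card_powerset T).le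
        exact mul_le_mul_of_nonneg_right h2 (by positivity)
    _ = _ := by ring

/-- Sets covering few vertices have bounded total inverse weight. -/
lemma sum_inv_pow_covered_le [Nonempty W] (m : ℕ) :
    ∑ S : Finset (Sym2 W) with (coveredVertices S).card ≤ m,
      ((Fintype.card W : ℝ) ^ (coveredVertices S).card)⁻¹ ≤ (m + 1) * 2 ^ ((m + 1) ^ 2) := by
  classical
  have hn : (0 : ℝ) < Fintype.card W := by exact_mod_cast Fintype.card_pos
  have hfib : ∀ U : Finset W, U.card ≤ m →
      ((Finset.univ.filter fun S : Finset (Sym2 W) => coveredVertices S = U).card : ℝ) ≤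
        2 ^ ((m + 1) ^ 2) := by
    intro U hU
    have h1 : (Finset.univ.filter fun S : Finset (Sym2 W) => coveredVertices S = U) ⊆
        U.sym2.powerset := by
      intro S hS
      have hS := (Finset.mem_filter.1 hS).2
      refine Finset.mem_powerset.2 fun e he => Finset.mem_sym2_iff.2 fun x hx => ?_
      rw [← hS]
      exact mem_coveredVertices.2 ⟨e, he, hx⟩
    have h2 := Finset.card_le_card h1
    rw [Finset.card_powerset, Finset.card_sym2] at h2
    have h3 : (U.card + 1).choose 2 ≤ (m + 1) ^ 2 :=
      (Nat.choose_le_pow _ _).trans (Nat.pow_le_pow_left (by omega) 2)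
    exact_mod_cast h2.trans (Nat.pow_le_pow_right (by norm_num) h3)
  calc ∑ S : Finset (Sym2 W) with (coveredVertices S).card ≤ m,
      ((Fintype.card W : ℝ) ^ (coveredVertices S).card)⁻¹
      = ∑ U : Finset W with U.card ≤ m, ∑ S : Finset (Sym2 W) with coveredVertices S = U,
          ((Fintype.card W : ℝ) ^ U.card)⁻¹ := by
        rw [← Finset.sum_fiberwise_of_maps_to (g := coveredVertices)
          (t := Finset.univ.filter fun U : Finset W => U.card ≤ m) (by intro S hS; simpa using hS)]
        refine Finset.sum_congr rfl fun U hU => ?_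
        rw [Finset.filter_filter]
        refine Finset.sum_congr ?_ ?_
        · ext S
          simp only [Finset.mem_filter, Finset.mem_univ, true_and] at hU ⊢
          constructor
          · rintro ⟨-, h⟩; exact h
          · rintro rfl; exact ⟨hU, rfl⟩
        · intro S hS
          rw [(Finset.mem_filter.1 hS).2]
    _ ≤ ∑ U : Finset W with U.card ≤ m, 2 ^ ((m + 1) ^ 2) * ((Fintype.card W : ℝ) ^ U.card)⁻¹ := by
        refine Finset.sum_le_sum fun U hU => ?_
        rw [Finset.sum_const, nsmul_eq_mul]
        exact mul_le_mul_of_nonneg_right (hfib U (Finset.mem_filter.1 hU).2) (by positivity)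
    _ = ∑ u ∈ Finset.range (m + 1), ∑ U : Finset W with U.card = u,
          2 ^ ((m + 1) ^ 2) * ((Fintype.card W : ℝ) ^ u)⁻¹ := by
        rw [← Finset.sum_fiberwise_of_maps_to (g := Finset.card)
          (t := Finset.range (m + 1)) (by intro S hS; simpa [Nat.lt_succ_iff] using hS)]
        refine Finset.sum_congr rfl fun u hu => ?_
        rw [Finset.filter_filter]
        refine Finset.sum_congr ?_ ?_
        · ext S
          simp only [Finset.mem_filter, Finset.mem_univ, true_and, Finset.mem_range] at hu ⊢
          omega
        · intro S hS
          rw [(Finset.mem_filter.1 hS).2]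
    _ ≤ ∑ u ∈ Finset.range (m + 1), 2 ^ ((m + 1) ^ 2) := by
        refine Finset.sum_le_sum fun u _ => ?_
        rw [Finset.sum_const, nsmul_eq_mul, Finset.univ_filter_card_eq,
          Finset.card_powersetCard, Finset.card_univ, mul_left_comm]
        refine mul_le_of_le_one_right (by positivity) ?_
        rw [mul_inv_le_iff₀ (by positivity), one_mul]
        exact_mod_cast Nat.choose_le_pow _ _
    _ = _ := by
        rw [Finset.sum_const, Finset.card_range, nsmul_eq_mul]; push_cast; ring

end Copies

lemma exists_large_nat (A M δ : ℝ) (hA : 0 ≤ A) (hδ : 0 < δ) (n₀ : ℕ) :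
    ∃ t : ℕ, 2 ≤ t ∧ n₀ ≤ t ∧ A * Real.log t + M + 1 ≤ δ / 2 * t := by
  have h1 := Real.isLittleO_log_id_atTop.def (show 0 < δ / (4 * (A + 1)) by positivity)
  have h2 := tendsto_natCast_atTop_atTop (R := ℝ) |>.eventually h1
  have h3 := tendsto_natCast_atTop_atTop (R := ℝ) |>.eventually
    (Filter.eventually_ge_atTop (4 * (M + 1) / δ))
  obtain ⟨t, h2, h3, h4, h5⟩ := (h2.and (h3.and ((Filter.eventually_ge_atTop 2).and
    (Filter.eventually_ge_atTop n₀)))).exists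
  refine ⟨t, h4, h5, ?_⟩
  rw [id, Real.norm_eq_abs, Real.norm_eq_abs, Nat.abs_cast] at h2
  have h6 := (le_abs_self _).trans h2
  rw [div_le_iff₀ hδ] at h3
  have h7 : A * Real.log t ≤ δ / 4 * t := by
    calc A * Real.log t ≤ A * (δ / (4 * (A + 1)) * t) := by gcongr
      _ ≤ (A + 1) * (δ / (4 * (A + 1)) * t) := by gcongr; linarith
      _ = _ := by field_simp
  linarith

section SparseRamsey

lemma pow_sub_le_of_densitySlack_nonneg {α : Type} [Fintype α] [DecidableEq α] {a b L t : ℕ}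
    (ht : 1 ≤ t) {S : Finset (Sym2 α)} (hS : S.Nonempty) (hdiag : ∀ e ∈ S, ¬ e.IsDiag)
    (hslack : 0 ≤ densitySlack a b S) :
    ((t : ℝ) ^ (a * L)) ^ (Fintype.card α - (coveredVertices S).card) ≤
      ((t : ℝ) ^ (b * L))⁻¹ ^ (S.card - 1) * ((t : ℝ) ^ (a * L)) ^ (Fintype.card α - 2) := by
  have ht0 : (0 : ℝ) < t := by exact_mod_cast ht
  rw [inv_pow, le_inv_mul_iff₀ (by positivity)]
  simp only [← pow_mul, ← pow_add]
  refine pow_le_pow_right₀ (by exact_mod_cast ht) ?_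
  have h2 := two_le_card_coveredVertices hS hdiag
  have hv : (coveredVertices S).card ≤ Fintype.card α := Finset.card_le_univ _
  have h1 := hS.card_pos
  obtain ⟨u, hu⟩ := Nat.exists_eq_add_of_le h2
  obtain ⟨w, hw⟩ := Nat.exists_eq_add_of_le hv
  obtain ⟨j, hj⟩ := Nat.exists_eq_add_of_le h1
  rw [densitySlack, hu, hj] at hslack
  push_cast at hslack
  have h3 : b * j ≤ a * u := by zify; nlinarith
  have e1 : Fintype.card α - (coveredVertices S).card = w := by omega
  have e2 : Fintype.card α - 2 = u + w := by omega
  have e3 : S.card - 1 = j := by omega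
  rw [e1, e2, e3]
  nlinarith [Nat.mul_le_mul_right L h3]

lemma inv_pow_le_of_densitySlack_neg {W : Type} [DecidableEq W] {a b L t : ℕ}
    (ht : 1 ≤ t) (hb : 0 < b) (hba : b ≤ a) {S : Finset (Sym2 W)} (hL : S.card < L)
    (hslack : densitySlack a b S < 0) :
    ((t : ℝ) ^ (b * L - 1))⁻¹ ^ S.card ≤
      (t : ℝ) ^ ((2 * a - b) * L) * (((t : ℝ) ^ (a * L)) ^ (coveredVertices S).card)⁻¹ := by
  have ht0 : (0 : ℝ) < t := by exact_mod_cast ht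
  rw [inv_pow, le_mul_inv_iff₀ (by positivity), inv_mul_le_iff₀ (by positivity)]
  simp only [← pow_mul, ← pow_add]
  refine pow_le_pow_right₀ (by exact_mod_cast ht) ?_
  obtain ⟨d, rfl⟩ := Nat.exists_eq_add_of_le hba
  have hbL : 1 ≤ b * L := Nat.mul_pos hb (by omega)
  have h2 : 2 * (b + d) - b = b + 2 * d := by omega
  rw [densitySlack] at hslack
  rw [h2]
  zify [hbL]
  push_cast at hslack ⊢
  have h3 : (S.card : ℤ) + 1 ≤ L := by exact_mod_cast hL
  have h4 := mul_le_mul_of_nonneg_right (Int.add_one_le_iff.2 hslack) (Nat.cast_nonneg (α := ℤ) L)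
  nlinarith

lemma pow_mul_two_pow_mul_lt {x δ p : ℝ} {X M C m : ℕ} (hx : 1 ≤ x) (hX : 1 ≤ X)
    (hp : p ≤ 1) (hm : δ * (x * X) ≤ p * m) (h : C * Real.log x + M + 1 ≤ δ / 2 * x) :
    x ^ (C * X) * (2 ^ (M * X) * (1 - p / 2) ^ m) < 1 / 2 := by
  have h1 : x ^ (C * X) = Real.exp (X * (C * Real.log x)) := by
    rw [← Real.exp_log (show 0 < x by linarith), ← Real.exp_nat_mul, Real.log_exp]
    push_cast; ring_nf
  have h2 : (2 : ℝ) ^ (M * X) ≤ Real.exp (M * X) := by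
    have : (2 : ℝ) ≤ Real.exp 1 := by linarith [Real.add_one_le_exp 1]
    calc (2 : ℝ) ^ (M * X) ≤ Real.exp 1 ^ (M * X) := by gcongr
      _ = _ := by rw [← Real.exp_nat_mul]; push_cast; ring_nf
  have h3 : (1 - p / 2) ^ m ≤ Real.exp (-(δ * (x * X) / 2)) := by
    calc (1 - p / 2) ^ m ≤ Real.exp (-(p / 2)) ^ m :=
          pow_le_pow_left₀ (by linarith) (Real.one_sub_le_exp_neg _) m
      _ = Real.exp (-(p * m / 2)) := by rw [← Real.exp_nat_mul]; ring_nf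
      _ ≤ _ := Real.exp_le_exp.2 (by linarith)
  have hX' : (1 : ℝ) ≤ X := by exact_mod_cast hX
  calc x ^ (C * X) * (2 ^ (M * X) * (1 - p / 2) ^ m)
      ≤ Real.exp (X * (C * Real.log x)) * (Real.exp (M * X) *
        Real.exp (-(δ * (x * X) / 2))) := by
        rw [h1]
        have : 0 ≤ (1 - p / 2) ^ m := pow_nonneg (by linarith) m
        gcongr
    _ = Real.exp (X * (C * Real.log x + M - δ / 2 * x)) := by
        rw [← Real.exp_add, ← Real.exp_add]; ring_nf
    _ ≤ Real.exp (-1) := Real.exp_le_exp.2 (by nlinarith)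
    _ < 1 / 2 := by
        rw [Real.exp_neg, ← one_div]
        refine one_div_lt_one_div_of_lt (by norm_num) ?_
        linarith [Real.exp_one_gt_d9]

lemma card_sym2_fin_le (n : ℕ) : Fintype.card (Sym2 (Fin n)) ≤ n ^ 2 := by
  rw [Sym2.card, Fintype.card_fin, Nat.choose_two_right, Nat.add_sub_cancel]
  refine Nat.div_le_of_le_mul ?_
  rcases Nat.eq_zero_or_pos n with rfl | h
  · simp
  · nlinarith

/-- Sets with negative slack contribute little to the expected number of bad sets. -/
lemma sum_pow_card_le {n a b K t : ℕ} (ht : 1 ≤ t) (hb : 0 < b) (hba : b ≤ a)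
    (hn : n = t ^ (a * (K + 1))) (𝓑 : Finset (Finset (Sym2 (Fin n))))
    (h𝓑 : ∀ S ∈ 𝓑, S.card ≤ K ∧ densitySlack a b S < 0) :
    ∑ S ∈ 𝓑, ((t : ℝ) ^ (b * (K + 1) - 1))⁻¹ ^ S.card ≤
      (t : ℝ) ^ ((2 * a - b) * (K + 1)) * ((2 * K + 1) * 2 ^ ((2 * K + 1) ^ 2)) := by
  have hn0 : n ≠ 0 := by rw [hn]; exact (Nat.pow_pos (by omega)).ne'
  have : NeZero n := ⟨hn0⟩
  have hnr : (Fintype.card (Fin n) : ℝ) = (t : ℝ) ^ (a * (K + 1)) := by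
    rw [Fintype.card_fin, hn]; push_cast; rfl
  have h1 := sum_inv_pow_covered_le (W := Fin n) (2 * K)
  push_cast at h1
  calc ∑ S ∈ 𝓑, ((t : ℝ) ^ (b * (K + 1) - 1))⁻¹ ^ S.card
      ≤ ∑ S ∈ 𝓑, (t : ℝ) ^ ((2 * a - b) * (K + 1)) *
        ((Fintype.card (Fin n) : ℝ) ^ (coveredVertices S).card)⁻¹ := by
        refine Finset.sum_le_sum fun S hS => ?_
        rw [hnr]
        exact inv_pow_le_of_densitySlack_neg ht hb hba (Nat.lt_succ_of_le (h𝓑 S hS).1) (h𝓑 S hS).2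
    _ = (t : ℝ) ^ ((2 * a - b) * (K + 1)) *
        ∑ S ∈ 𝓑, ((Fintype.card (Fin n) : ℝ) ^ (coveredVertices S).card)⁻¹ := by
        rw [Finset.mul_sum]
    _ ≤ (t : ℝ) ^ ((2 * a - b) * (K + 1)) *
        ∑ S : Finset (Sym2 (Fin n)) with (coveredVertices S).card ≤ 2 * K,
        ((Fintype.card (Fin n) : ℝ) ^ (coveredVertices S).card)⁻¹ := by
        refine mul_le_mul_of_nonneg_left (Finset.sum_le_sum_of_subset_of_nonneg ?_ ?_)
          (by positivity)
        · intro S hS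
          refine Finset.mem_filter.2 ⟨Finset.mem_univ _, ?_⟩
          have := card_coveredVertices_le S
          have := (h𝓑 S hS).1
          omega
        · intros; positivity
    _ ≤ _ := mul_le_mul_of_nonneg_left h1 (by positivity)

/-- There are locally sparse graphs that are Ramsey for `T`. -/
theorem exists_sparse_ramsey {α : Type} [Fintype α] [DecidableEq α] (T : Finset (Sym2 α))
    (hT : T.Nonempty) (hdiag : ∀ e ∈ T, ¬ e.IsDiag) {a b : ℕ} (hb : 0 < b) (hba : b ≤ a)
    (hslack : ∀ S ⊆ T, S.Nonempty → 0 ≤ densitySlack a b S) (K : ℕ) :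
    ∃ (n : ℕ) (E : Finset (Sym2 (Fin n))),
      (∀ S ⊆ E, S.Nonempty → S.card ≤ K → 0 ≤ densitySlack a b S) ∧
      ∀ R ⊆ E, ∃ f : α → Fin n, Function.Injective f ∧
        (T.image (Sym2.map f) ⊆ R ∨ T.image (Sym2.map f) ⊆ E \ R) := by
  classical
  obtain ⟨γ, δ, hγ, hδ, n₀, hmany⟩ := exists_many_embeddings T hdiag
  have hv : 2 ≤ Fintype.card α := by
    obtain ⟨e, he⟩ := hT
    rw [← Sym2.card_toFinset_of_not_isDiag e (hdiag e he)]
    exact Finset.card_le_univ _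
  set v := Fintype.card α with hvdef
  set κ : ℝ := 2 ^ T.card * (v : ℝ) ^ v with hκ
  have hκ0 : 0 < κ := by
    have : (0 : ℝ) < v := by exact_mod_cast (by omega : 0 < v)
    positivity
  obtain ⟨r, hr⟩ := exists_containers T.card (γ / κ) (by positivity)
  set A : ℕ := (2 * a * (K + 1) + 1) * (2 * (2 * T.card * r)) with hA
  set M : ℕ := 2 * ((2 * K + 1) * 2 ^ ((2 * K + 1) ^ 2)) with hM
  obtain ⟨t, ht2, htn₀, ht⟩ := exists_large_nat A M δ (by positivity) hδ n₀
  have ht0 : (0 : ℝ) < t := by exact_mod_cast (by omega : 0 < t)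
  have ht1 : 1 ≤ t := by omega
  have htr : (1 : ℝ) ≤ t := by exact_mod_cast ht1
  set n : ℕ := t ^ (a * (K + 1)) with hn
  set X : ℕ := t ^ ((2 * a - b) * (K + 1)) with hX
  have hX1 : 1 ≤ X := Nat.one_le_pow _ _ ht1
  set q : ℝ := ((t : ℝ) ^ (b * (K + 1)))⁻¹ with hq
  set p : ℝ := ((t : ℝ) ^ (b * (K + 1) - 1))⁻¹ with hp
  have hnr : (n : ℝ) = (t : ℝ) ^ (a * (K + 1)) := by rw [hn]; push_cast; rfl
  have hXr : (X : ℝ) = (t : ℝ) ^ ((2 * a - b) * (K + 1)) := by rw [hX]; push_cast; rfl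
  have hn1 : 1 ≤ n := Nat.one_le_pow _ _ ht1
  have hnn₀ : n₀ ≤ n := htn₀.trans (Nat.le_self_pow (by
    have : 0 < a := by omega
    positivity) t)
  have : NeZero n := ⟨by omega⟩
  have hqX : q * n ^ 2 = X := by
    rw [hq, hnr, hXr, inv_mul_eq_iff_eq_mul₀ (by positivity), ← pow_mul, ← pow_add]
    congr 1
    obtain ⟨d, rfl⟩ := Nat.exists_eq_add_of_le hba
    rw [show 2 * (b + d) - b = b + 2 * d by omega]
    ring
  have hpX : p * n ^ 2 = t * X := by
    have hbK : b * (K + 1) = (b * (K + 1) - 1) + 1 :=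
      (Nat.sub_add_cancel (Nat.mul_pos hb (Nat.succ_pos K))).symm
    have : p = t * q := by
      rw [hp, hq, hbK, pow_succ, Nat.add_sub_cancel]
      field_simp
    rw [this, mul_assoc, hqX]
  have hq0 : 0 < q := by positivity
  have hp0 : 0 < p := by positivity
  have hp1 : p ≤ 1 := inv_le_one_of_one_le₀ (one_le_pow₀ htr)
  have hN := card_sym2_fin_le n
  have hNr : (Fintype.card (Sym2 (Fin n)) : ℝ) ≤ n ^ 2 := by exact_mod_cast hN
  have hnpos : (0 : ℝ) < n := by exact_mod_cast hn1
  obtain ⟨𝓒, h𝓒card, h𝓒, hcont⟩ := hr (Sym2 (Fin n)) (copyWeight T)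
    (κ * (n : ℝ) ^ (v - 2)) q (2 * X) (by positivity) hq0
    (by push_cast; rw [← hqX]; nlinarith) (fun e => Nat.cast_nonneg _)
    (fun e he => by
      obtain ⟨f, hf⟩ := Finset.card_pos.1 (Nat.pos_of_ne_zero fun h => he (by
        rw [copyWeight, h, Nat.cast_zero]))
      obtain ⟨hinj, rfl⟩ := (Finset.mem_filter.1 hf).2
      exact Finset.card_image_of_injective _ (Sym2.map.injective hinj))
    (fun J hJ => by
      have := weightDegree_copyWeight_le (W := Fin n) T hq0.le (fun S hS hne => by
        rw [Fintype.card_fin, hnr]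
        exact pow_sub_le_of_densitySlack_nonneg ht1 hne (fun e he => hdiag e (hS he))
          (hslack S hS hne)) hJ
      rwa [Fintype.card_fin] at this)
  have hfew : ∀ C ∈ 𝓒, ((embeddingsInto T C).card : ℝ) < γ * n ^ v := by
    intro C hC
    have h1 := h𝓒 C hC
    rw [sum_copyWeight T fun e => e ⊆ C] at h1
    refine lt_of_lt_of_le h1 ?_
    calc γ / κ * Fintype.card (Sym2 (Fin n)) * (κ * (n : ℝ) ^ (v - 2))
        ≤ γ / κ * n ^ 2 * (κ * (n : ℝ) ^ (v - 2)) := by gcongr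
      _ = γ * (n ^ 2 * (n : ℝ) ^ (v - 2)) := by field_simp
      _ = γ * n ^ v := by rw [← pow_add, Nat.add_sub_cancel' hv]
  set 𝓓 : Finset (Finset (Sym2 (Fin n))) :=
    (𝓒 ×ˢ 𝓒).image fun C => (C.1 ∪ C.2)ᶜ with h𝓓
  have h𝓓large : ∀ D ∈ 𝓓, δ * n ^ 2 ≤ (D.card : ℝ) := by
    intro D hD
    obtain ⟨⟨C₁, C₂⟩, hC, rfl⟩ := Finset.mem_image.1 hD
    obtain ⟨hC₁, hC₂⟩ := Finset.mem_product.1 hC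
    by_contra! hlt
    rcases hmany n hnn₀ C₁ C₂ hlt.le with h | h
    · exact absurd (hfew C₁ hC₁) (not_lt.2 h)
    · exact absurd (hfew C₂ hC₂) (not_lt.2 h)
  have h𝓓card : (𝓓.card : ℝ) ≤ (t : ℝ) ^ (A * X) := by
    have h1 : Fintype.card (Sym2 (Fin n)) + 1 ≤ t ^ (2 * a * (K + 1) + 1) := by
      calc Fintype.card (Sym2 (Fin n)) + 1 ≤ n ^ 2 * t := by nlinarith [Nat.one_le_pow 2 n hn1]
        _ = _ := by rw [hn, pow_succ, ← pow_mul]; ring_nf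
    have h2 : 𝓓.card ≤ 𝓒.card * 𝓒.card := Finset.card_image_le.trans (Finset.card_product _ _).le
    have h3 : 𝓓.card ≤ t ^ (A * X) := by
      calc 𝓓.card ≤ 𝓒.card * 𝓒.card := h2
        _ ≤ (t ^ (2 * a * (K + 1) + 1)) ^ (2 * X * T.card * r) *
            (t ^ (2 * a * (K + 1) + 1)) ^ (2 * X * T.card * r) := by
          have := h𝓒card.trans (Nat.pow_le_pow_left h1 _)
          exact Nat.mul_le_mul this this
        _ = _ := by rw [← pow_mul, ← pow_add, hA]; ring_nf
    exact_mod_cast h3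
  set 𝓑 : Finset (Finset (Sym2 (Fin n))) :=
    Finset.univ.filter fun S => S.Nonempty ∧ S.card ≤ K ∧ densitySlack a b S < 0 with h𝓑
  have hMpos : 0 < M := by positivity
  have hsecond : ∑ S ∈ 𝓑, p ^ S.card / ((M * X : ℕ) : ℝ) ≤ 1 / 2 := by
    rw [← Finset.sum_div, div_le_iff₀ (by exact_mod_cast Nat.mul_pos hMpos hX1)]
    refine (sum_pow_card_le ht1 hb hba hn 𝓑 fun S hS => (Finset.mem_filter.1 hS).2.2).trans
      (le_of_eq ?_)
    rw [hM]
    push_cast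
    rw [hXr]
    ring
  have hfirst : ∑ D ∈ 𝓓, 2 ^ (M * X) * (1 - p / 2) ^ D.card < 1 / 2 := by
    set m : ℕ := ⌈δ * (n : ℝ) ^ 2⌉₊ with hm
    calc ∑ D ∈ 𝓓, 2 ^ (M * X) * (1 - p / 2) ^ D.card
        ≤ ∑ D ∈ 𝓓, 2 ^ (M * X) * (1 - p / 2) ^ m := by
          refine Finset.sum_le_sum fun D hD => ?_
          refine mul_le_mul_of_nonneg_left ?_ (by positivity)
          exact pow_le_pow_of_le_one (by linarith) (by linarith) (Nat.ceil_le.2 (h𝓓large D hD))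
      _ = 𝓓.card * (2 ^ (M * X) * (1 - p / 2) ^ m) := by rw [Finset.sum_const, nsmul_eq_mul]
      _ ≤ (t : ℝ) ^ (A * X) * (2 ^ (M * X) * (1 - p / 2) ^ m) := by
          refine mul_le_mul_of_nonneg_right h𝓓card ?_
          exact mul_nonneg (by positivity) (pow_nonneg (by linarith) m)
      _ < 1 / 2 := by
          refine pow_mul_two_pow_mul_lt (δ := δ) htr hX1 hp1 ?_ ht
          rw [← hpX]
          have := mul_le_mul_of_nonneg_left (Nat.le_ceil (δ * (n : ℝ) ^ 2)) hp0.le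
          linarith
  obtain ⟨G, hG𝓓, hG𝓑⟩ := exists_subset_of_expectation hp0.le hp1 𝓓 𝓑
    (Nat.mul_pos hMpos hX1) (by linarith)
  generalize M * X = k at hG𝓓 hG𝓑
  have hpick : ∀ S : Finset (Sym2 (Fin n)), ∃ e, S.Nonempty → e ∈ S := fun S => by
    by_cases h : S.Nonempty
    · exact ⟨h.choose, fun _ => h.choose_spec⟩
    · exact ⟨s(0, 0), fun h' => absurd h' h⟩
  choose pick hpick using hpick
  set Z := (𝓑.filter fun S => S ⊆ G).image pick with hZ
  have hZcard : Z.card ≤ k := Finset.card_image_le.trans hG𝓑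
  refine ⟨n, G \ Z, ?_, ?_⟩
  · intro S hS hne hSK
    by_contra! hneg
    have hS𝓑 : S ∈ 𝓑.filter fun S => S ⊆ G := Finset.mem_filter.2
      ⟨Finset.mem_filter.2 ⟨Finset.mem_univ _, hne, hSK, hneg⟩, hS.trans Finset.sdiff_subset⟩
    exact (Finset.mem_sdiff.1 (hS (hpick S hne))).2 (Finset.mem_image_of_mem pick hS𝓑)
  · intro R hR
    by_contra! hno
    have hind : ∀ I : Finset (Sym2 (Fin n)), (∀ f : α → Fin n, Function.Injective f →
        ¬ T.image (Sym2.map f) ⊆ I) → ∃ C ∈ 𝓒, I ⊆ C := by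
      intro I hI
      refine hcont I fun e he => ?_
      rw [copyWeight, Nat.cast_eq_zero, Finset.card_eq_zero, Finset.filter_eq_empty_iff]
      rintro f - ⟨hf, rfl⟩
      exact hI f hf he
    obtain ⟨C₁, hC₁, hRC₁⟩ := hind R fun f hf => (hno f hf).1
    obtain ⟨C₂, hC₂, hRC₂⟩ := hind ((G \ Z) \ R) fun f hf => (hno f hf).2
    have h1 : k < (G ∩ (C₁ ∪ C₂)ᶜ).card :=
      hG𝓓 _ (Finset.mem_image.2 ⟨(C₁, C₂), Finset.mk_mem_product hC₁ hC₂, rfl⟩)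
    have h2 : G ∩ (C₁ ∪ C₂)ᶜ ⊆ Z := by
      intro e he
      obtain ⟨heG, heC⟩ := Finset.mem_inter.1 he
      rw [Finset.mem_compl, Finset.mem_union, not_or] at heC
      by_contra heZ
      by_cases heR : e ∈ R
      · exact heC.1 (hRC₁ heR)
      · exact heC.2 (hRC₂ (Finset.mem_sdiff.2 ⟨Finset.mem_sdiff.2 ⟨heG, heZ⟩, heR⟩))
    exact absurd (h1.trans_le (Finset.card_le_card h2)) (not_lt.2 hZcard)

end SparseRamsey

section Balanced

variable {α : Type} [DecidableEq α]

/-- A set of edges of maximum density, minimal among those, is strictly balanced. -/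
lemma exists_strictly_balanced (T : Finset (Sym2 α)) (hdiag : ∀ e ∈ T, ¬ e.IsDiag)
    {C : Finset (Sym2 α)} (hCT : C ⊆ T) (hC : 2 ≤ C.card)
    (hCcov : (coveredVertices C).card ≤ C.card) :
    ∃ (a b : ℕ) (J : Finset (Sym2 α)), 0 < b ∧ b ≤ a ∧ J ⊆ T ∧ 3 ≤ J.card ∧
      densitySlack a b J = 0 ∧ (∀ S ⊆ T, S.Nonempty → 0 ≤ densitySlack a b S) ∧
      ∀ Y ⊂ J, 2 ≤ Y.card → 0 < densitySlack a b Y := by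
  set ρ : Finset (Sym2 α) → ℚ := fun S =>
    ((S.card : ℚ) - 1) / ((coveredVertices S).card - 2) with hρ
  set 𝓢 := T.powerset.filter fun S => 2 ≤ S.card with h𝓢
  have hmem : ∀ {S}, S ∈ 𝓢 ↔ S ⊆ T ∧ 2 ≤ S.card := by simp [h𝓢]
  obtain ⟨J₀, hJ₀, hmax⟩ := 𝓢.exists_max_image ρ ⟨C, hmem.2 ⟨hCT, hC⟩⟩
  obtain ⟨J, hJ, hmin⟩ := (𝓢.filter fun S => ρ S = ρ J₀).exists_min_image Finset.card
    ⟨J₀, Finset.mem_filter.2 ⟨hJ₀, rfl⟩⟩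
  obtain ⟨hJ𝓢, hρJ⟩ := Finset.mem_filter.1 hJ
  obtain ⟨hJT, hJ2⟩ := hmem.1 hJ𝓢
  have hcov : ∀ {S}, S ∈ 𝓢 → 3 ≤ (coveredVertices S).card := fun hS =>
    three_le_card_coveredVertices (hmem.1 hS).2 fun e he => hdiag e ((hmem.1 hS).1 he)
  obtain ⟨a, ha⟩ := Nat.exists_eq_add_of_le hJ2
  obtain ⟨b, hb⟩ := Nat.exists_eq_add_of_le (hcov hJ𝓢)
  have hslack : ∀ S ∈ 𝓢, (0 ≤ densitySlack (a + 1) (b + 1) S) ∧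
      (densitySlack (a + 1) (b + 1) S = 0 → ρ S = ρ J) := by
    intro S hS
    have h1 : (0 : ℚ) < (coveredVertices S).card - 2 := by
      have : (3 : ℚ) ≤ (coveredVertices S).card := by exact_mod_cast hcov hS
      linarith
    have h2 : (0 : ℚ) < (coveredVertices J).card - 2 := by
      have : (3 : ℚ) ≤ (coveredVertices J).card := by exact_mod_cast hcov hJ𝓢
      linarith
    have hs : ((densitySlack (a + 1) (b + 1) S : ℤ) : ℚ) =
        ((J.card : ℚ) - 1) * ((coveredVertices S).card - 2) -
          ((S.card : ℚ) - 1) * ((coveredVertices J).card - 2) := by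
      rw [densitySlack, ha, hb]; push_cast; ring
    constructor
    · have h3 := hmax S hS
      rw [← hρJ, div_le_div_iff₀ h1 h2] at h3
      have : (0 : ℚ) ≤ (densitySlack (a + 1) (b + 1) S : ℤ) := by rw [hs]; linarith
      exact_mod_cast this
    · intro h3
      rw [h3, Int.cast_zero] at hs
      rw [hρ]
      simp only
      rw [div_eq_div_iff h1.ne' h2.ne']
      linarith
  have hCs := (hslack C (hmem.2 ⟨hCT, hC⟩)).1
  have hba : b < a := by
    by_contra! hab
    rw [densitySlack] at hCs
    have h3 : (3 : ℤ) ≤ (coveredVertices C).card := by exact_mod_cast hcov (hmem.2 ⟨hCT, hC⟩)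
    have h4 : ((coveredVertices C).card : ℤ) ≤ C.card := by exact_mod_cast hCcov
    have h5 : (a : ℤ) ≤ b := by exact_mod_cast hab
    push_cast at hCs
    nlinarith
  refine ⟨a + 1, b + 1, J, Nat.succ_pos b, by omega, hJT, by omega, ?_, ?_, ?_⟩
  · rw [densitySlack, ha, hb]; push_cast; ring
  · intro S hS hne
    rcases Nat.lt_or_ge S.card 2 with h | h
    · have h1 : S.card = 1 := by have := hne.card_pos; omega
      have h2 : (2 : ℤ) ≤ (coveredVertices S).card := by
        exact_mod_cast two_le_card_coveredVertices hne fun e he => hdiag e (hS he)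
      rw [densitySlack, h1]
      push_cast
      nlinarith
    · exact (hslack S (hmem.2 ⟨hS, h⟩)).1
  · intro Y hY hY2
    have hY𝓢 : Y ∈ 𝓢 := hmem.2 ⟨hY.subset.trans hJT, hY2⟩
    obtain ⟨h1, h2⟩ := hslack Y hY𝓢
    refine lt_of_le_of_ne h1 fun h => ?_
    exact absurd (hmin Y (Finset.mem_filter.2 ⟨hY𝓢, (h2 h.symm).trans hρJ⟩))
      (not_le.2 (Finset.card_lt_card hY))

lemma exists_cycle_edges {F : SimpleGraph α} (hF : ¬ F.IsAcyclic) :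
    ∃ C : Finset (Sym2 α), (∀ e ∈ C, e ∈ F.edgeSet) ∧ 2 ≤ C.card ∧
      (coveredVertices C).card ≤ C.card := by
  rw [IsAcyclic] at hF
  push Not at hF
  obtain ⟨u, p, hp⟩ := hF
  have hcard : p.edges.toFinset.card = p.length := by
    rw [List.toFinset_card_of_nodup hp.edges_nodup, Walk.length_edges]
  refine ⟨p.edges.toFinset, fun e he => p.edges_subset_edgeSet (List.mem_toFinset.1 he), ?_, ?_⟩
  · rw [hcard]; exact le_trans (by norm_num) hp.three_le_length
  · rw [hcard]
    have h1 : coveredVertices p.edges.toFinset ⊆ p.support.tail.toFinset := by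
      intro x hx
      obtain ⟨e, he, hxe⟩ := mem_coveredVertices.1 hx
      have hxs : x ∈ p.support := p.mem_support_of_mem_edges (List.mem_toFinset.1 he) hxe
      rw [List.mem_toFinset]
      rcases (p.mem_support_iff).1 hxs with rfl | h
      · exact p.end_mem_tail_support hp.not_nil
      · exact h
    refine (Finset.card_le_card h1).trans ((List.toFinset_card_le _).trans ?_)
    rw [List.length_tail, Walk.length_support, Nat.add_sub_cancel]

end Balanced

section Arrow

variable {α V W : Type}

lemma ArrowNNI.of_injective_hom {F : SimpleGraph α} {G : SimpleGraph V} {G' : SimpleGraph W}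
    {r : ℕ} (h : ArrowNNI G F r) (φ : G →g G') (hφ : Function.Injective φ) :
    ArrowNNI G' F r := by
  intro c
  obtain ⟨f, hf, k, hk⟩ := h fun e => c (e.map φ)
  exact ⟨φ.comp f, hφ.comp hf, k, hk⟩

lemma not_arrowNNI_of_densitySlack [DecidableEq α] [DecidableEq W] {F : SimpleGraph α}
    {a b : ℕ} {J : Finset (Sym2 α)} (hJF : ∀ e ∈ J, e ∈ F.edgeSet) (hJ : 3 ≤ J.card)
    (htight : densitySlack a b J = 0) (hbal : ∀ Y ⊂ J, 2 ≤ Y.card → 0 < densitySlack a b Y)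
    {H : SimpleGraph V} {g : V → W} (hg : Function.Injective g) {S : Finset (Sym2 W)}
    (hHS : ∀ e ∈ H.edgeSet, e.map g ∈ S)
    (hS : ∀ S' ⊆ S, S'.Nonempty → 0 ≤ densitySlack a b S') : ¬ ArrowNNI H F 2 := by
  intro hH
  obtain ⟨R, hRS, hR⟩ := exists_splitting a b
    {X | ∃ f : α → W, Function.Injective f ∧ X = J.image (Sym2.map f)}
    (by
      rintro X ⟨f, hf, rfl⟩
      rwa [Finset.card_image_of_injective _ (Sym2.map.injective hf)])
    (by
      rintro X ⟨f, hf, rfl⟩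
      rwa [densitySlack_image a b hf])
    (by
      rintro X ⟨f, hf, rfl⟩ Y hY hY2
      obtain ⟨Y', hY', rfl⟩ := Finset.subset_image_iff.1 hY.subset
      rw [Finset.card_image_of_injective _ (Sym2.map.injective hf)] at hY2
      rw [densitySlack_image a b hf]
      refine hbal Y' (Finset.ssubset_iff_subset_ne.2 ⟨hY', ?_⟩) hY2
      rintro rfl
      exact (ssubset_irrefl _ hY).elim)
    S hS
  obtain ⟨f, hf, k, hk⟩ := hH fun e => if e.map g ∈ R then 0 else 1
  have hcol : ∀ e ∈ J, (if (e.map f).map g ∈ R then (0 : Fin 2) else 1) = k ∧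
      (e.map f).map g ∈ S := by
    intro e he
    have heF := hJF e he
    induction e using Sym2.ind with
    | _ x y => exact ⟨hk x y heF, hHS _ (f.map_adj heF)⟩
  obtain ⟨h1, h2⟩ := hR (J.image (Sym2.map (g ∘ f))) ⟨g ∘ f, hg.comp hf, rfl⟩
  by_cases hk0 : k = 0
  · refine h1 fun e' he' => ?_
    obtain ⟨e, he, rfl⟩ := Finset.mem_image.1 he'
    have := (hcol e he).1
    rw [← Sym2.map_map]
    by_contra hnot
    rw [if_neg hnot, hk0] at this
    exact one_ne_zero this
  · refine h2 fun e' he' => ?_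
    obtain ⟨e, he, rfl⟩ := Finset.mem_image.1 he'
    obtain ⟨h3, h4⟩ := hcol e he
    rw [← Sym2.map_map]
    refine Finset.mem_sdiff.2 ⟨h4, fun hmem => hk0 ?_⟩
    rw [if_pos hmem] at h3
    exact h3.symm

lemma arrowNNI_fromEdgeSet [DecidableEq α] [DecidableEq W] {F : SimpleGraph α}
    {T : Finset (Sym2 α)} (hT : ∀ e, e ∈ T ↔ e ∈ F.edgeSet) {E : Finset (Sym2 W)}
    (hE : ∀ R ⊆ E, ∃ f : α → W, Function.Injective f ∧
      (T.image (Sym2.map f) ⊆ R ∨ T.image (Sym2.map f) ⊆ E \ R)) :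
    ArrowNNI (fromEdgeSet (E : Set (Sym2 W))) F 2 := by
  intro c
  have hER : E.filter (fun e => c e = 0) ⊆ E := Finset.filter_subset _ _
  obtain ⟨f, hf, h⟩ := hE _ hER
  have hmem : ∀ {x y}, F.Adj x y → s(f x, f y) ∈ T.image (Sym2.map f) := fun {x y} hxy =>
    Finset.mem_image.2 ⟨s(x, y), (hT _).2 hxy, rfl⟩
  refine ⟨⟨f, fun {x y} hxy => (fromEdgeSet_adj _).2 ⟨?_, hf.ne hxy.ne⟩⟩, hf, ?_⟩
  · rcases h with h | h
    · exact hER (h (hmem hxy))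
    · exact (Finset.mem_sdiff.1 (h (hmem hxy))).1
  · rcases h with h | h
    · exact ⟨0, fun x y hxy => (Finset.mem_filter.1 (h (hmem hxy))).2⟩
    · refine ⟨1, fun x y hxy => ?_⟩
      obtain ⟨h1, h2⟩ := Finset.mem_sdiff.1 (h (hmem hxy))
      have h3 : c s(f x, f y) ≠ 0 := fun h0 => h2 (Finset.mem_filter.2 ⟨h1, h0⟩)
      exact Fin.eq_one_of_ne_zero _ h3

/-- A proper subgraph has fewer vertices and edges, counted together. -/
lemma card_add_ncard_edgeSet_lt {n m : ℕ} {G : SimpleGraph (Fin n)} {H : G.Subgraph}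
    (hH : H ≠ ⊤) {G' : SimpleGraph (Fin m)} (φ : G' ≃g H.coe) :
    m + G'.edgeSet.ncard < n + G.edgeSet.ncard := by
  set ψ : Fin m → Fin n := fun x => (φ x : Fin n) with hψ
  have hinj : Function.Injective ψ := Subtype.val_injective.comp φ.injective
  have hm : m ≤ n := by simpa using Fintype.card_le_of_injective ψ hinj
  have hsub : Sym2.map ψ '' G'.edgeSet ⊆ G.edgeSet := by
    rintro _ ⟨e, he, rfl⟩
    induction e using Sym2.ind with
    | _ x y => exact H.adj_sub (φ.map_adj_iff.2 he)
  have hcard : (Sym2.map ψ '' G'.edgeSet).ncard = G'.edgeSet.ncard :=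
    Set.ncard_image_of_injective _ (Sym2.map.injective hinj)
  have hle := Set.ncard_le_ncard hsub (Set.toFinite _)
  by_contra! hge
  have hmn : m = n := by omega
  have heq : Sym2.map ψ '' G'.edgeSet = G.edgeSet :=
    Set.eq_of_subset_of_ncard_le hsub (by omega) (Set.toFinite _)
  have hsurj : Function.Surjective ψ :=
    ((Fintype.bijective_iff_injective_and_card ψ).2 ⟨hinj, by simpa using hmn⟩).2
  refine hH (Subgraph.ext ?_ ?_)
  · refine Set.eq_univ_of_forall fun x => ?_
    obtain ⟨y, rfl⟩ := hsurj x
    exact (φ y).2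
  · ext x y
    refine ⟨H.adj_sub, fun hxy => ?_⟩
    have : s(x, y) ∈ Sym2.map ψ '' G'.edgeSet := heq ▸ hxy
    obtain ⟨e, he, hexy⟩ := this
    induction e using Sym2.ind with
    | _ z w =>
      have h1 : s(ψ z, ψ w) ∈ H.edgeSet := φ.map_adj_iff.2 he
      rw [Sym2.map_mk] at hexy
      exact (hexy ▸ h1 : s(x, y) ∈ H.edgeSet)

end Arrow

/-- **Every graph containing a cycle is Ramsey infinite.**  There are minimal Ramsey
graphs for `F` and two colours with arbitrarily many edges; since a minimal Ramsey graph
is determined up to isomorphism by finitely many edge counts, this expresses that there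
are infinitely many pairwise non-isomorphic minimal Ramsey graphs.  Minimality is with
respect to all proper subgraphs (elements `H ≠ ⊤` of the subgraph lattice, allowing both
vertex and edge deletions). -/
theorem ramsey_infinite {α : Type} [Fintype α] (F : SimpleGraph α)
    (hF : ¬ F.IsAcyclic) (N : ℕ) :
    ∃ (n : ℕ) (G : SimpleGraph (Fin n)),
      N ≤ G.edgeSet.ncard ∧
      ArrowNNI G F 2 ∧
      ∀ H : G.Subgraph, H ≠ ⊤ → ¬ ArrowNNI H.coe F 2 := by
  classical
  obtain ⟨C, hCF, hC2, hCcov⟩ := exists_cycle_edges hF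
  set T : Finset (Sym2 α) := Finset.univ.filter fun e => e ∈ F.edgeSet with hTdef
  have hT : ∀ e, e ∈ T ↔ e ∈ F.edgeSet := by simp [hTdef]
  have hdiag : ∀ e ∈ T, ¬ e.IsDiag := fun e he => F.not_isDiag_of_mem_edgeSet ((hT e).1 he)
  have hCT : C ⊆ T := fun e he => (hT e).2 (hCF e he)
  obtain ⟨a, b, J, hb, hba, hJT, hJ3, htight, hslack, hbal⟩ :=
    exists_strictly_balanced T hdiag hCT hC2 hCcov
  have hTne : T.Nonempty := (Finset.card_pos.1 (by omega : 0 < C.card)).mono hCT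
  obtain ⟨n₀, E, hsparse, hramsey⟩ := exists_sparse_ramsey T hTne hdiag hb hba hslack N
  have hex : ∃ m, ∃ (n : ℕ) (G : SimpleGraph (Fin n)), n + G.edgeSet.ncard = m ∧
      ArrowNNI G F 2 ∧ ∃ g : G →g fromEdgeSet (E : Set (Sym2 (Fin n₀))), Function.Injective g :=
    ⟨_, n₀, _, rfl, arrowNNI_fromEdgeSet hT hramsey, Hom.id, Function.injective_id⟩
  obtain ⟨n, G, hnG, hG, g, hg⟩ := Nat.find_spec hex
  refine ⟨n, G, ?_, hG, fun H hH hHF => ?_⟩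
  · by_contra! hlt
    have hcard : (G.edgeSet.toFinset.image (Sym2.map g)).card ≤ N :=
      Finset.card_image_le.trans (by rw [← Set.ncard_eq_toFinset_card']; exact hlt.le)
    refine not_arrowNNI_of_densitySlack (fun e he => (hT e).1 (hJT he)) hJ3 htight hbal hg
      (S := G.edgeSet.toFinset.image (Sym2.map g))
      (fun e he => Finset.mem_image_of_mem _ (Set.mem_toFinset.2 he))
      (fun S hS hne => hsparse S (fun e he => ?_) hne ((Finset.card_le_card hS).trans hcard)) hG
    obtain ⟨e, heG, rfl⟩ := Finset.mem_image.1 (hS he)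
    rw [Set.mem_toFinset] at heG
    induction e using Sym2.ind with
    | _ x y => exact ((fromEdgeSet_adj _).1 (g.map_adj heG)).1
  · have φ : H.coe.comap (Fintype.equivFin H.verts).symm ≃g H.coe :=
      Iso.comap (Fintype.equivFin H.verts).symm H.coe
    refine Nat.find_min hex (hnG ▸ card_add_ncard_edgeSet_lt hH φ) ⟨_, _, rfl,
      hHF.of_injective_hom φ.symm.toHom φ.symm.injective, g.comp (H.hom.comp φ.toHom), ?_⟩
    exact hg.comp (Subtype.val_injective.comp φ.injective)
end

section
/- For all integers ℓ ≥ 3 and m ≥ 1 there exists an integer r (depending only on ℓ and m) such that every graph H without a subgraph isomorphic to (m, C_ℓ) satisfies H ↛nni (C_ℓ)_r, i.e., there is an r-colouring of the edges of H with no monochromatic cycle of length ℓ. -/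
open SimpleGraph

/-- `H` contains a copy of the graph `(m, F)` obtained by gluing `m` copies of `F` along
a single common edge. -/
def HasGluedCopies {α V : Type*} (F : SimpleGraph α) (H : SimpleGraph V) (m : ℕ) : Prop :=
  ∃ (f : Fin m → F →g H) (x y : V), H.Adj x y ∧
    (∀ i, Function.Injective (f i)) ∧
    (∀ i, ∃ a b, F.Adj a b ∧ f i a = x ∧ f i b = y) ∧
    (∀ i j, i ≠ j → Set.range (f i) ∩ Set.range (f j) = {x, y})

section Colouring

variable {X : Type*}

/-- On a finite set, a digraph of out-degree at most `d` has a proper `(2 * d + 1)`-colouring. -/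
theorem exists_colouring_on_finset (D : X → Finset X) (d : ℕ) (hD : ∀ x, (D x).card ≤ d)
    (A : Finset X) :
    ∃ c : X → Fin (2 * d + 1), ∀ a ∈ A, ∀ b ∈ A, b ∈ D a → a ≠ b → c a ≠ c b := by
  classical
  induction A using Finset.strongInduction with
  | H A ih =>
    rcases A.eq_empty_or_nonempty with rfl | hA
    · exact ⟨fun _ => 0, by simp⟩
    obtain ⟨a, ha, hdeg⟩ : ∃ a ∈ A, (A.filter fun b => a ∈ D b).card ≤ d := by
      apply Finset.exists_le_of_sum_le hA
      calc ∑ a ∈ A, (A.filter fun b => a ∈ D b).card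
          = ∑ b ∈ A, (A.filter fun a => a ∈ D b).card :=
            (Finset.sum_card_bipartiteAbove_eq_sum_card_bipartiteBelow fun a b => a ∈ D b)
        _ ≤ ∑ _b ∈ A, d := Finset.sum_le_sum fun b _ =>
            (Finset.card_le_card fun x hx => (Finset.mem_filter.1 hx).2).trans (hD b)
    obtain ⟨c, hc⟩ := ih (A.erase a) (Finset.erase_ssubset ha)
    obtain ⟨k, hk⟩ : ∃ k, k ∉ (D a ∪ A.filter fun b => a ∈ D b).image c := by
      by_contra! h
      have h₁ : (Finset.univ : Finset (Fin (2 * d + 1))).card ≤ _ :=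
        Finset.card_le_card fun k _ => h k
      have h₂ := Finset.card_image_le (f := c) (s := D a ∪ A.filter fun b => a ∈ D b)
      have h₃ := Finset.card_union_le (D a) (A.filter fun b => a ∈ D b)
      have h₄ := hD a
      rw [Finset.card_univ, Fintype.card_fin] at h₁
      omega
    simp only [Finset.mem_image, Finset.mem_union, Finset.mem_filter, not_exists, not_and] at hk
    refine ⟨Function.update c a k, fun x hx y hy hxy hne => ?_⟩
    by_cases hxa : x = a
    · subst hxa
      rw [Function.update_self, Function.update_of_ne hne.symm]
      exact fun h => hk y (.inl hxy) h.symm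
    by_cases hya : y = a
    · subst hya
      rw [Function.update_self, Function.update_of_ne hne]
      exact hk x (.inr ⟨hx, hxy⟩)
    rw [Function.update_of_ne hxa, Function.update_of_ne hya]
    exact hc x (Finset.mem_erase.2 ⟨hxa, hx⟩) y (Finset.mem_erase.2 ⟨hya, hy⟩) hxy hne

/-- A digraph of out-degree at most `d` has a proper `(2 * d + 1)`-colouring. -/
theorem exists_colouring_of_card_le (D : X → Finset X) (d : ℕ) (hD : ∀ x, (D x).card ≤ d) :
    ∃ c : X → Fin (2 * d + 1), ∀ a b, b ∈ D a → a ≠ b → c a ≠ c b := by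
  classical
  choose g hg using exists_colouring_on_finset D d hD
  obtain ⟨c, hc⟩ := Finset.rado_selection (β := fun _ : X => Fin (2 * d + 1)) g
  refine ⟨c, fun a b hab hne => ?_⟩
  obtain ⟨t, ht, hct⟩ := hc {a, b}
  rw [hct a (by simp), hct b (by simp)]
  exact hg t a (ht (by simp)) b (ht (by simp)) hab hne

end Colouring

section Cycles

variable {V : Type*} {H : SimpleGraph V} {n : ℕ}

/-- `F` lists the vertices of an `(n + 3)`-cycle of `H` in cyclic order. -/
def IsCycleMap (H : SimpleGraph V) (F : Fin (n + 3) → V) : Prop :=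
  Function.Injective F ∧ ∀ i, H.Adj (F i) (F (i + 1))

/-- There are `N` cycles that agree with `F` on `S` and are pairwise disjoint off `S`. -/
def IsFat (H : SimpleGraph V) (N : ℕ) (F : Fin (n + 3) → V) (S : Finset (Fin (n + 3))) : Prop :=
  ∃ G : Fin N → Fin (n + 3) → V, (∀ j, IsCycleMap H (G j)) ∧ (∀ j, ∀ i ∈ S, G j i = F i) ∧
    ∀ j k, j ≠ k → ∀ p ∉ S, ∀ q ∉ S, G j p ≠ G k q

theorem IsCycleMap.rotate {F : Fin (n + 3) → V} (hF : IsCycleMap H F) (a : Fin (n + 3)) :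
    IsCycleMap H fun i => F (a + i) :=
  ⟨fun i j hij => add_left_cancel (hF.1 hij), fun i => by simpa [add_assoc] using hF.2 (a + i)⟩

theorem IsCycleMap.isFat_univ {F : Fin (n + 3) → V} (hF : IsCycleMap H F) (N : ℕ) :
    IsFat H N F Finset.univ :=
  ⟨fun _ => F, fun _ => hF, fun _ _ _ => rfl, fun _ _ _ p hp => absurd (Finset.mem_univ p) hp⟩

theorem IsFat.mono {M N : ℕ} (hMN : M ≤ N) {F : Fin (n + 3) → V} {S : Finset (Fin (n + 3))}
    (h : IsFat H N F S) : IsFat H M F S := by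
  obtain ⟨G, h₁, h₂, h₃⟩ := h
  exact ⟨fun j => G (Fin.castLE hMN j), fun _ => h₁ _, fun _ => h₂ _,
    fun j k hjk => h₃ _ _ fun h => hjk (Fin.castLE_injective hMN h)⟩

theorem IsFat.congr {N : ℕ} {F F' : Fin (n + 3) → V} {S : Finset (Fin (n + 3))}
    (h : IsFat H N F S) (hFF' : ∀ i ∈ S, F i = F' i) : IsFat H N F' S := by
  obtain ⟨G, h₁, h₂, h₃⟩ := h
  exact ⟨G, h₁, fun j i hi => (h₂ j i hi).trans (hFF' i hi), h₃⟩

/-- If `S` is not fat, a bounded set of vertices meets every extension of `F` off `S`. -/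
theorem exists_cover_of_not_isFat {N : ℕ} {F : Fin (n + 3) → V} {S : Finset (Fin (n + 3))}
    (h : ¬ IsFat H N F S) :
    ∃ T : Finset V, T.card ≤ N * (n + 3) ∧ ∀ F', IsCycleMap H F' → (∀ i ∈ S, F' i = F i) →
      ∃ p ∉ S, F' p ∈ T := by
  classical
  obtain ⟨k, hkN, ⟨G, h₁, h₂, h₃⟩, hk'⟩ :
      ∃ k < N, IsFat H k F S ∧ ¬ IsFat H (k + 1) F S := by
    by_contra! hcon
    have hall : ∀ k ≤ N, IsFat H k F S := by
      intro k
      induction k with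
      | zero => exact fun _ => ⟨fun j => j.elim0, fun j => j.elim0, fun j => j.elim0,
          fun j => j.elim0⟩
      | succ k ih => exact fun hk => hcon k hk (ih (by omega))
    exact h (hall N le_rfl)
  refine ⟨Finset.univ.image fun x : Fin k × Fin (n + 3) => G x.1 x.2, ?_, ?_⟩
  · refine Finset.card_image_le.trans ?_
    rw [Finset.card_univ, Fintype.card_prod, Fintype.card_fin, Fintype.card_fin]
    exact Nat.mul_le_mul_right _ hkN.le
  · intro F' hF' hFF'
    by_contra! hcon
    have hne : ∀ p ∉ S, ∀ j q, F' p ≠ G j q := fun p hp j q hpq =>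
      hcon p hp (Finset.mem_image.2 ⟨(j, q), Finset.mem_univ _, hpq.symm⟩)
    refine hk' ⟨Fin.cons F' G, ?_, ?_, ?_⟩
    · exact fun j => Fin.cases hF' h₁ j
    · exact fun j => Fin.cases hFF' h₂ j
    · intro j l
      refine Fin.cases ?_ (fun j => ?_) j <;> refine Fin.cases ?_ (fun l => ?_) l
      · exact fun h => absurd rfl h
      · exact fun _ p hp q _ => hne p hp l q
      · exact fun _ p _ q hq => (hne q hq j p).symm
      · exact fun hjl => h₃ j l fun h => hjl (congrArg _ h)

/-- A bound for the number of vertices needed in fat kernels when `d` positions are free. -/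
def kernelBound (n N : ℕ) : ℕ → ℕ
  | 0 => n + 3
  | d + 1 => (n + 3) + (n + 3) * (N * (n + 3)) * kernelBound n N d

theorem le_kernelBound (n N d : ℕ) : n + 3 ≤ kernelBound n N d := by
  cases d <;> simp [kernelBound]

theorem exists_kernels (N : ℕ) (d : ℕ) : ∀ (S : Finset (Fin (n + 3))) (g : Fin (n + 3) → V),
    Sᶜ.card = d → ∃ B : Finset V, B.card ≤ kernelBound n N d ∧
      ∀ F, IsCycleMap H F → (∀ i ∈ S, F i = g i) →
        ∃ S', S ⊆ S' ∧ (∀ i ∈ S', F i ∈ B) ∧ IsFat H N F S' := by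
  classical
  induction d with
  | zero =>
    intro S g hS
    obtain rfl : S = Finset.univ := by simpa using hS
    refine ⟨Finset.univ.image g, ?_, fun F hF hFg => ⟨_, subset_rfl, fun i hi => ?_,
      hF.isFat_univ N⟩⟩
    · exact Finset.card_image_le.trans (by simp [kernelBound])
    · rw [hFg i hi]; exact Finset.mem_image_of_mem _ hi
  | succ d ih =>
    intro S g hS
    by_cases hfat : IsFat H N g S
    · refine ⟨S.image g, ?_, fun F _ hFg => ⟨S, subset_rfl, fun i hi => ?_,
        hfat.congr fun i hi => (hFg i hi).symm⟩⟩
      · refine (Finset.card_image_le.trans (Finset.card_le_univ S)).trans ?_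
        rw [Fintype.card_fin]
        exact le_kernelBound ..
      · rw [hFg i hi]; exact Finset.mem_image_of_mem _ hi
    · obtain ⟨T, hT, hcover⟩ := exists_cover_of_not_isFat hfat
      have hbranch : ∀ x : Fin (n + 3) × V, ∃ B : Finset V, B.card ≤ kernelBound n N d ∧
          (x.1 ∉ S → ∀ F, IsCycleMap H F → (∀ i ∈ S, F i = g i) → F x.1 = x.2 →
            ∃ S', S ⊆ S' ∧ (∀ i ∈ S', F i ∈ B) ∧ IsFat H N F S') := by
        intro x
        by_cases hx : x.1 ∈ S
        · exact ⟨∅, by simp, fun h => absurd hx h⟩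
        obtain ⟨B, hB, hB'⟩ := ih (insert x.1 S) (Function.update g x.1 x.2) (by
          rw [Finset.card_compl, Finset.card_insert_of_notMem hx]
          rw [Finset.card_compl] at hS
          omega)
        refine ⟨B, hB, fun _ F hF hFg hFx => ?_⟩
        obtain ⟨S', h₁, h₂⟩ := hB' F hF (by
          intro i hi
          rcases eq_or_ne i x.1 with rfl | hne
          · rw [Function.update_self, hFx]
          · rw [Function.update_of_ne hne]
            exact hFg i (Finset.mem_of_mem_insert_of_ne hi hne))
        exact ⟨S', (Finset.subset_insert _ _).trans h₁, h₂⟩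
      choose B hB hB' using hbranch
      refine ⟨(Finset.univ ×ˢ T).biUnion B, ?_, fun F hF hFg => ?_⟩
      · refine (Finset.card_biUnion_le_card_mul _ _ _ fun x _ => hB x).trans ?_
        rw [Finset.card_product, Finset.card_univ, Fintype.card_fin, kernelBound]
        exact le_add_left (Nat.mul_le_mul_right _ (Nat.mul_le_mul_left _ hT))
      · obtain ⟨p, hp, hpT⟩ := hcover F hF hFg
        obtain ⟨S', h₁, h₂, h₃⟩ := hB' (p, F p) hp F hF hFg rfl
        exact ⟨S', h₁, fun i hi => Finset.mem_biUnion.2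
          ⟨(p, F p), by simp [hpT], h₂ i hi⟩, h₃⟩

/-- A bound for the number of vertices in the kernels of the cycles through a given edge. -/
def edgeBound (n N : ℕ) : ℕ := 2 * kernelBound n N (n + 1)

theorem exists_edge_kernels (H : SimpleGraph V) (n N : ℕ) (e : Sym2 V) :
    ∃ B : Finset V, B.card ≤ edgeBound n N ∧
      ∀ F : Fin (n + 3) → V, IsCycleMap H F → s(F 0, F 1) = e →
        ∃ S : Finset (Fin (n + 3)), 0 ∈ S ∧ 1 ∈ S ∧ (∀ i ∈ S, F i ∈ B) ∧ IsFat H N F S := by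
  classical
  induction e using Sym2.ind with
  | _ x y =>
  have hcard : ({0, 1} : Finset (Fin (n + 3)))ᶜ.card = n + 1 := by
    rw [Finset.card_compl, Finset.card_pair (by simp), Fintype.card_fin]
    omega
  have key : ∀ x y : V, ∃ B : Finset V, B.card ≤ kernelBound n N (n + 1) ∧
      ∀ F : Fin (n + 3) → V, IsCycleMap H F → F 0 = x → F 1 = y →
        ∃ S : Finset (Fin (n + 3)), 0 ∈ S ∧ 1 ∈ S ∧ (∀ i ∈ S, F i ∈ B) ∧ IsFat H N F S := by
    intro x y
    obtain ⟨B, hB, hB'⟩ := exists_kernels (H := H) N (n + 1) {0, 1}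
      (fun i => if i = 0 then x else y) hcard
    refine ⟨B, hB, fun F hF hx hy => ?_⟩
    obtain ⟨S, hS, h⟩ := hB' F hF (by simp [hx, hy])
    exact ⟨S, hS (by simp), hS (by simp), h⟩
  obtain ⟨B, hB, hB'⟩ := key x y
  obtain ⟨C, hC, hC'⟩ := key y x
  refine ⟨B ∪ C, (Finset.card_union_le _ _).trans (by unfold edgeBound; omega), fun F hF he => ?_⟩
  rcases Sym2.eq_iff.1 he with ⟨hx, hy⟩ | ⟨hx, hy⟩
  · obtain ⟨S, h₀, h₁, hSB, hS⟩ := hB' F hF hx hy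
    exact ⟨S, h₀, h₁, fun i hi => Finset.mem_union_left _ (hSB i hi), hS⟩
  · obtain ⟨S, h₀, h₁, hSC, hS⟩ := hC' F hF hx hy
    exact ⟨S, h₀, h₁, fun i hi => Finset.mem_union_right _ (hSC i hi), hS⟩

theorem Fin.one_add_one : (1 + 1 : Fin (n + 3)) = 2 :=
  Fin.ext (by rw [Fin.val_add_one_of_lt (by simp [Fin.lt_def]), Fin.val_one, Fin.val_two])

theorem Fin.val_add_one_cases (i : Fin (n + 3)) :
    ((i + 1).val = i.val + 1) ∨ i + 1 = 0 := by
  rcases eq_or_ne i (Fin.last (n + 2)) with rfl | h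
  · exact .inr (Fin.last_add_one _)
  · exact .inl (Fin.val_add_one_of_lt (Fin.lt_last_iff_ne_last.2 h))

/-- A fat set spanning the initial segment `{0, …, t}` makes that whole segment fat. -/
theorem IsFat.segment {N : ℕ} {F : Fin (n + 3) → V} (hF : IsCycleMap H F)
    {S : Finset (Fin (n + 3))} (h : IsFat H (N + (n + 3)) F S) (t : Fin (n + 3))
    (h₀ : 0 ∈ S) (ht : t ∈ S) (hSt : ∀ i ∈ S, i ≤ t) : IsFat H N F (Finset.Iic t) := by
  classical
  obtain ⟨G, h₁, h₂, h₃⟩ := h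
  let good := Finset.univ.filter fun j => ∀ p ∉ S, ∀ q, G j p ≠ F q
  have hbad : goodᶜ.card ≤ n + 3 := by
    have : ∀ j : Fin (N + (n + 3)), ∃ q, j ∈ goodᶜ → ∃ p ∉ S, G j p = F q := by
      intro j
      by_cases hj : j ∈ good
      · exact ⟨0, fun h => absurd hj (Finset.mem_compl.1 h)⟩
      · have hj' := hj
        simp only [good, Finset.mem_filter, Finset.mem_univ, true_and] at hj'
        push Not at hj'
        obtain ⟨p, hp, q, hpq⟩ := hj'
        exact ⟨q, fun _ => ⟨p, hp, hpq⟩⟩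
    choose q hq using this
    have := Finset.card_le_card_of_injOn q (s := goodᶜ) (t := Finset.univ)
      (fun _ _ => by simp) (by
        intro j hj k hk hjk
        by_contra hne
        obtain ⟨p, hp, hpq⟩ := hq j hj
        obtain ⟨p', hp', hpq'⟩ := hq k hk
        exact h₃ j k hne p hp p' hp' (by rw [hpq, hpq', hjk]))
    simpa using this
  have hgood : N ≤ good.card := by
    rw [Finset.card_compl, Fintype.card_fin] at hbad
    omega
  let e : Fin N → Fin (N + (n + 3)) := fun j => good.orderEmbOfFin rfl (Fin.castLE hgood j)
  have he : Function.Injective e :=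
    (good.orderEmbOfFin rfl).injective.comp (Fin.castLE_injective hgood)
  have heg : ∀ j, ∀ p ∉ S, ∀ q, G (e j) p ≠ F q := fun j =>
    (Finset.mem_filter.1 (good.orderEmbOfFin_mem rfl (Fin.castLE hgood j))).2
  have hnot : ∀ {i}, ¬ i ≤ t → i ∉ S := fun hi hiS => hi (hSt _ hiS)
  refine ⟨fun j i => if i ≤ t then F i else G (e j) i, fun j => ⟨?_, ?_⟩, ?_, ?_⟩
  · intro p q hpq
    dsimp only at hpq
    split_ifs at hpq with hp hq hq
    · exact hF.1 hpq
    · exact absurd hpq.symm (heg j q (hnot hq) p)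
    · exact absurd hpq (heg j p (hnot hp) q)
    · exact (h₁ _).1 hpq
  · intro i
    dsimp only
    split_ifs with hi hi' hi'
    · exact hF.2 i
    · have hit : i = t := by
        rcases Fin.val_add_one_cases i with h | h
        · rw [Fin.le_def] at hi hi'
          exact Fin.ext (by omega)
        · exact absurd (h ▸ Fin.zero_le t) hi'
      rw [hit, ← h₂ (e j) t ht]
      exact (h₁ _).2 t
    · have hi0 : i + 1 = 0 := by
        rcases Fin.val_add_one_cases i with h | h
        · rw [Fin.le_def] at hi hi'
          omega
        · exact h
      rw [hi0, ← h₂ (e j) 0 h₀, ← hi0]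
      exact (h₁ _).2 i
    · exact (h₁ _).2 i
  · intro j i hi
    exact if_pos (Finset.mem_Iic.1 hi)
  · intro j k hjk p hp q hq
    rw [Finset.mem_Iic] at hp hq
    dsimp only
    rw [if_neg hp, if_neg hq]
    exact h₃ _ _ (fun h => hjk (he h)) p (hnot hp) q (hnot hq)

/-- A fat edge carries glued copies of the cycle. -/
theorem IsFat.hasGluedCopies {m : ℕ} {F : Fin (n + 3) → V} (hF : IsCycleMap H F)
    (h : IsFat H m F (Finset.Iic 1)) : HasGluedCopies (cycleGraph (n + 3)) H m := by
  obtain ⟨G, h₁, h₂, h₃⟩ := h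
  have hmem : ∀ i : Fin (n + 3), i ∈ Finset.Iic 1 → i = 0 ∨ i = 1 := by
    intro i hi
    rw [Finset.mem_Iic, Fin.le_def, Fin.val_one] at hi
    rcases Nat.le_one_iff_eq_zero_or_eq_one.1 hi with h | h
    · exact .inl (Fin.ext h)
    · exact .inr (Fin.ext h)
  have e₀ : ∀ j, G j 0 = F 0 := fun j => h₂ j 0 (by simp)
  have e₁ : ∀ j, G j 1 = F 1 := fun j => h₂ j 1 (by simp)
  refine ⟨fun j => ⟨G j, ?_⟩, F 0, F 1, by simpa using hF.2 0, fun j => (h₁ j).1,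
    fun j => ⟨0, 1, by simp [cycleGraph_adj], e₀ j, e₁ j⟩, fun j k hjk => ?_⟩
  · intro u v huv
    rcases cycleGraph_adj.1 huv with h | h
    · rw [sub_eq_iff_eq_add'.1 h]
      exact ((h₁ j).2 v).symm
    · rw [sub_eq_iff_eq_add'.1 h]
      exact (h₁ j).2 u
  · ext v
    simp only [Set.mem_inter_iff, Set.mem_range, Set.mem_insert_iff, Set.mem_singleton_iff,
      RelHom.coeFn_mk]
    constructor
    · rintro ⟨⟨p, rfl⟩, q, hpq⟩
      by_cases hp : p ∈ Finset.Iic 1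
      · rcases hmem p hp with rfl | rfl
        · exact .inl (e₀ j)
        · exact .inr (e₁ j)
      by_cases hq : q ∈ Finset.Iic 1
      · rw [← hpq]
        rcases hmem q hq with rfl | rfl
        · exact .inl (e₀ k)
        · exact .inr (e₁ k)
      exact absurd hpq.symm (h₃ j k hjk p hp q hq)
    · rintro (rfl | rfl)
      · exact ⟨⟨0, e₀ j⟩, 0, e₀ k⟩
      · exact ⟨⟨1, e₁ j⟩, 1, e₁ k⟩

/-- The number of petals required of a fat segment with `k` edges. -/
def petals (n m : ℕ) : ℕ → ℕ
  | 0 => m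
  | k + 1 => petals n m k + edgeBound n (petals n m k + (n + 3)) + 1

theorem petals_mono (n m : ℕ) : Monotone (petals n m) :=
  monotone_nat_of_le_succ fun k => by rw [petals]; omega

/-- A cycle with a fat segment of at least two edges has a shorter fat segment, unless two of its
edges lie close together in terms of the kernels `B`. -/
theorem exists_shorter_segment {m k : ℕ} {B : Sym2 V → Finset V}
    (hBcard : ∀ e, (B e).card ≤ edgeBound n (petals n m k + (n + 3)))
    (hB : ∀ e, ∀ F : Fin (n + 3) → V, IsCycleMap H F → s(F 0, F 1) = e →
      ∃ S : Finset (Fin (n + 3)), 0 ∈ S ∧ 1 ∈ S ∧ (∀ i ∈ S, F i ∈ B e) ∧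
        IsFat H (petals n m k + (n + 3)) F S)
    {F : Fin (n + 3) → V} (hF : IsCycleMap H F)
    (hsep : ¬ (F 0 ∈ B s(F 1, F 2) ∧ F 1 ∈ B s(F 1, F 2)))
    (t : Fin (n + 3)) (htk : t.val = k + 1) (hk : 1 ≤ k)
    (hfat : IsFat H (petals n m t) F (Finset.Iic t)) :
    ∃ u : Fin (n + 3), 1 ≤ u ∧ u < t ∧ IsFat H (petals n m u) (fun i => F (1 + i))
      (Finset.Iic u) := by
  classical
  obtain ⟨G, h₁, h₂, h₃⟩ := hfat
  have h12 : (1 + 1 : Fin (n + 3)) = 2 := Fin.one_add_one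
  have ht2 : (2 : Fin (n + 3)) ≤ t := by
    rw [Fin.le_def, htk, Fin.val_two]; omega
  have ht1 : (1 : Fin (n + 3)) ≤ t := by
    rw [Fin.le_def, htk, Fin.val_one]; omega
  have hedge : ∀ j, s(G j (1 + 0), G j (1 + 1)) = s(F 1, F 2) := fun j => by
    rw [add_zero, h12, h₂ j 1 (Finset.mem_Iic.2 ht1), h₂ j 2 (Finset.mem_Iic.2 ht2)]
  choose S hS₀ hS₁ hSB hS using fun j =>
    hB s(F 1, F 2) (fun i => G j (1 + i)) ((h₁ j).rotate 1) (hedge j)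
  obtain ⟨j, hj⟩ : ∃ j, ∀ i ∈ S j, 1 + i ≤ t := by
    by_contra! hcon
    choose p hp hpt using hcon
    have hcard := Finset.card_le_card_of_injOn (fun j => G j (1 + p j)) (s := Finset.univ)
      (t := B s(F 1, F 2)) (fun j _ => hSB j _ (hp j)) (by
        intro j _ l _ hjl
        by_contra hne
        exact h₃ j l hne _ (fun h => (hpt j).not_ge (Finset.mem_Iic.1 h)) _
          (fun h => (hpt l).not_ge (Finset.mem_Iic.1 h)) hjl)
    rw [Finset.card_univ, Fintype.card_fin, htk, petals] at hcard
    have := hBcard s(F 1, F 2)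
    omega
  have hGF : ∀ i ∈ S j, G j (1 + i) = F (1 + i) := fun i hi => h₂ j _ (Finset.mem_Iic.2 (hj i hi))
  have hne0 : ∀ i ∈ S j, 1 + i ≠ 0 := by
    intro i hi h0
    refine hsep ⟨?_, ?_⟩
    · have := hSB j i hi
      rwa [hGF i hi, h0] at this
    · have := hSB j 0 (hS₀ j)
      rwa [hGF 0 (hS₀ j), add_zero] at this
  have hlt : ∀ i ∈ S j, i < t := by
    intro i hi
    have h1 := hj i hi
    have h2 := hne0 i hi
    rw [add_comm 1 i] at h1 h2
    rw [Fin.lt_def]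
    rw [Fin.le_def] at h1
    have := (Fin.val_add_one_cases i).resolve_right h2
    omega
  have hne : (S j).Nonempty := ⟨0, hS₀ j⟩
  refine ⟨(S j).max' hne, (S j).le_max' _ (hS₁ j), hlt _ ((S j).max'_mem hne), ?_⟩
  have hlt' := hlt _ ((S j).max'_mem hne)
  rw [Fin.lt_def, htk] at hlt'
  exact (((hS j).congr hGF).segment (hF.rotate 1) _ (hS₀ j) ((S j).max'_mem hne)
    fun i hi => (S j).le_max' i hi).mono (petals_mono n m (by omega))

/-- A cycle of a graph without glued copies has two consecutive edges that lie close together. -/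
theorem exists_close_edges {m : ℕ} {B : ℕ → Sym2 V → Finset V}
    (hBcard : ∀ k e, (B k e).card ≤ edgeBound n (petals n m k + (n + 3)))
    (hB : ∀ k e, ∀ F : Fin (n + 3) → V, IsCycleMap H F → s(F 0, F 1) = e →
      ∃ S : Finset (Fin (n + 3)), 0 ∈ S ∧ 1 ∈ S ∧ (∀ i ∈ S, F i ∈ B k e) ∧
        IsFat H (petals n m k + (n + 3)) F S)
    (hH : ¬ HasGluedCopies (cycleGraph (n + 3)) H m) {F : Fin (n + 3) → V}
    (hF : IsCycleMap H F) :
    ∃ k < n + 3, ∃ a, F a ∈ B k s(F (a + 1), F (a + 2)) ∧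
      F (a + 1) ∈ B k s(F (a + 1), F (a + 2)) := by
  by_contra! hcon
  have main : ∀ (k : ℕ) (t : Fin (n + 3)), t.val = k → 1 ≤ k → ∀ a,
      ¬ IsFat H (petals n m t) (fun i => F (a + i)) (Finset.Iic t) := by
    intro k
    induction k using Nat.strong_induction_on with
    | _ k ih =>
      intro t htk hk a hfat
      rcases eq_or_lt_of_le hk with rfl | hk1
      · obtain rfl : t = 1 := Fin.ext htk
        exact hH ((hfat.mono (petals_mono n m (Nat.zero_le _))).hasGluedCopies (hF.rotate a))
      · obtain ⟨k, rfl⟩ : ∃ l, k = l + 1 := ⟨k - 1, by omega⟩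
        obtain ⟨u, hu1, hut, hu⟩ := exists_shorter_segment (hBcard k) (hB k) (hF.rotate a)
          (fun h => hcon k (by omega) a (by simpa using h.1) (by simpa using h.2))
          t htk (by omega) hfat
        rw [Fin.le_def, Fin.val_one] at hu1
        exact ih u (by rw [← htk]; exact hut) u rfl hu1 (a + 1) (by simpa [add_assoc] using hu)
  refine main (n + 2) (Fin.last _) rfl (by omega) 0 ?_
  have huniv : Finset.Iic (Fin.last (n + 2)) = Finset.univ := by
    ext i
    simp [Fin.le_last]
  rw [huniv]
  exact (hF.rotate 0).isFat_univ _

end Cycles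

/-- For all `ℓ ≥ 3` and `m ≥ 1` there is an `r` (depending only on `ℓ` and `m`) such
that every graph `H` without a subgraph isomorphic to `(m, C_ℓ)` satisfies
`H ↛nni (C_ℓ)_r`. -/
theorem cycle_glued_free_graphs_are_not_ramsey (ℓ m : ℕ) (hℓ : 3 ≤ ℓ) (hm : 1 ≤ m) :
    ∃ r : ℕ, ∀ (V : Type) (H : SimpleGraph V),
      ¬ HasGluedCopies (cycleGraph ℓ) H m → ¬ ArrowNNI H (cycleGraph ℓ) r := by
  classical
  obtain ⟨n, rfl⟩ : ∃ n, ℓ = n + 3 := ⟨ℓ - 3, by omega⟩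
  let b : ℕ := ∑ k ∈ Finset.range (n + 3), edgeBound n (petals n m k + (n + 3))
  refine ⟨2 * (b * b) + 1, fun V H hH harrow => ?_⟩
  choose B hBcard hB using fun (k : ℕ) (e : Sym2 V) =>
    exists_edge_kernels H n (petals n m k + (n + 3)) e
  let A : Sym2 V → Finset V := fun e => (Finset.range (n + 3)).biUnion fun k => B k e
  have hA : ∀ e, (A e).card ≤ b := fun e =>
    Finset.card_biUnion_le.trans (Finset.sum_le_sum fun k _ => hBcard k e)
  let D : Sym2 V → Finset (Sym2 V) := fun e => (A e ×ˢ A e).image fun x => s(x.1, x.2)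
  have hD : ∀ e, (D e).card ≤ b * b := fun e => by
    refine Finset.card_image_le.trans ?_
    rw [Finset.card_product]
    exact Nat.mul_le_mul (hA e) (hA e)
  obtain ⟨c, hc⟩ := exists_colouring_of_card_le D (b * b) hD
  obtain ⟨f, hf, κ, hκ⟩ := harrow c
  have hadj : ∀ i : Fin (n + 3), (cycleGraph (n + 3)).Adj i (i + 1) := fun i => by
    simp [cycleGraph_adj]
  obtain ⟨k, hk, a, h₀, h₁⟩ := exists_close_edges hBcard hB hH
    (F := f) ⟨hf, fun i => f.map_adj (hadj i)⟩
  have h12 : a + 1 + 1 = a + 2 := by rw [add_assoc, Fin.one_add_one]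
  refine hc s(f (a + 1), f (a + 2)) s(f a, f (a + 1)) ?_ ?_ ?_
  · exact Finset.mem_image.2 ⟨(f a, f (a + 1)), Finset.mem_product.2
      ⟨Finset.mem_biUnion.2 ⟨k, Finset.mem_range.2 hk, h₀⟩,
        Finset.mem_biUnion.2 ⟨k, Finset.mem_range.2 hk, h₁⟩⟩, rfl⟩
  · intro h
    have h2 : (2 : Fin (n + 3)) ≠ 0 := Fin.ne_of_val_ne (by rw [Fin.val_two]; simp)
    rcases Sym2.eq_iff.1 h with ⟨h, -⟩ | ⟨-, h⟩
    · exact absurd (hf h) (by simp)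
    · exact h2 (by simpa using hf h)
  · rw [hκ _ _ (hadj a), ← h12, hκ _ _ (hadj (a + 1))]
end

section
/- For every graph F containing a cycle and every nonempty forest 𝒻 of copies of F, the union graph ⋃𝒻 satisfies ⋃𝒻 ↛nni (F)_2, i.e., there is a 2-colouring of the edges of ⋃𝒻 with no monochromatic subgraph isomorphic to F. -/
open SimpleGraph

/-- The condition that an enumeration `F 0, F 1, …` of graphs (given as subgraphs of an
ambient graph `G`) forms a forest of copies. -/
def ForestCond {V : Type*} {G : SimpleGraph V} {m : ℕ} (F : Fin m → G.Subgraph) : Prop :=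
  ∀ j : Fin m, (j : ℕ) ≠ 0 →
    ((F j).verts ∩ ⋃ (i : Fin m) (_ : i < j), (F i).verts) = ∅ ∨
    (∃ v, ((F j).verts ∩ ⋃ (i : Fin m) (_ : i < j), (F i).verts) = {v}) ∨
    (∃ x y, (F j).Adj x y ∧ (∃ i : Fin m, i < j ∧ (F i).Adj x y) ∧
      ((F j).verts ∩ ⋃ (i : Fin m) (_ : i < j), (F i).verts) = {x, y})

/-- A set of graphs is a *forest of copies* if it admits an enumeration satisfying
`ForestCond`. -/
def IsForestOfCopies {V : Type*} {G : SimpleGraph V} (𝒻 : Set G.Subgraph) : Prop :=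
  ∃ (m : ℕ) (F : Fin m → G.Subgraph), Function.Injective F ∧
    (∀ H, H ∈ 𝒻 ↔ ∃ i, F i = H) ∧ ForestCond F

section EdgeSets

open scoped Classical

variable {V W : Type*}

/-- The degree of `v` in the finite edge set `S`, modulo `2`. -/
noncomputable def edgeParity (S : Finset (Sym2 V)) (v : V) : ZMod 2 :=
  ∑ e ∈ S, if v ∈ e then 1 else 0

/-- A finite edge set is even if all its degrees are even. -/
def IsEvenEdgeSet (S : Finset (Sym2 V)) : Prop :=
  ∀ v, edgeParity S v = 0

/-- Every nonempty even subset of `E` has at least `g` edges. -/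
def EvenGirthGe (g : ℕ) (E : Set (Sym2 V)) : Prop :=
  ∀ S : Finset (Sym2 V), S.Nonempty → ↑S ⊆ E → IsEvenEdgeSet S → g ≤ S.card

/-- `S` is an even subset of `E` with exactly `g` edges. If `g` is the girth of `E`, these are
the edge sets of the shortest cycles. -/
structure IsShortCycle (g : ℕ) (E : Set (Sym2 V)) (S : Finset (Sym2 V)) : Prop where
  subset : ↑S ⊆ E
  card : S.card = g
  even : IsEvenEdgeSet S

/-- Two edges are related if they lie on a common short cycle. -/
def OnShortCycle (g : ℕ) (E : Set (Sym2 V)) (e f : Sym2 V) : Prop :=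
  ∃ S, IsShortCycle g E S ∧ e ∈ S ∧ f ∈ S

/-- The equivalence relation on edges generated by lying on a common short cycle. -/
def cycleSetoid (g : ℕ) (E : Set (Sym2 V)) : Setoid (Sym2 V) where
  r := Relation.ReflTransGen (OnShortCycle g E)
  iseqv :=
    { refl := fun _ => .refl
      symm := fun h =>
        have : Std.Symm (OnShortCycle g E) := ⟨fun _ _ ⟨S, hS, ha, hb⟩ => ⟨S, hS, hb, ha⟩⟩
        Std.Symm.symm _ _ h
      trans := fun h h' => h.trans h' }

/-- A set of edges is monochromatic if all its edges have the same colour. -/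
def IsMono {K : Type*} (c : Sym2 V → K) (T : Set (Sym2 V)) : Prop :=
  ∃ k, ∀ e ∈ T, c e = k

theorem edgeParity_eq_zero {S : Finset (Sym2 V)} {v : V} (h : ∀ e ∈ S, v ∉ e) :
    edgeParity S v = 0 :=
  Finset.sum_eq_zero fun e he => by simp [h e he]

theorem edgeParity_singleton (e : Sym2 V) (v : V) :
    edgeParity {e} v = if v ∈ e then 1 else 0 :=
  Finset.sum_singleton _ _

theorem edgeParity_union {S T : Finset (Sym2 V)} (h : Disjoint S T) (v : V) :
    edgeParity (S ∪ T) v = edgeParity S v + edgeParity T v :=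
  Finset.sum_union h

/-- The handshake lemma: the degrees of a loopless edge set have an even sum. -/
theorem sum_edgeParity {S : Finset (Sym2 V)} (hS : ∀ e ∈ S, ¬ e.IsDiag) {U : Finset V}
    (hU : ∀ e ∈ S, ∀ v ∈ e, v ∈ U) : ∑ v ∈ U, edgeParity S v = 0 := by
  unfold edgeParity
  rw [Finset.sum_comm]
  refine Finset.sum_eq_zero fun e he => ?_
  have hd := hS e he
  have hm := hU e he
  induction e using Sym2.ind with
  | _ a b =>
    have hab : a ≠ b := by simpa using hd
    have : U.filter (fun v => v ∈ s(a, b)) = {a, b} := by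
      ext v
      simp only [Finset.mem_filter, Finset.mem_insert, Finset.mem_singleton, Sym2.mem_iff]
      exact ⟨fun h => h.2, fun h => ⟨hm v (by simpa using h), h⟩⟩
    rw [Finset.sum_boole, this, Finset.card_pair hab]
    rfl

theorem edgeParity_add_eq_zero {S : Finset (Sym2 V)} (hS : ∀ e ∈ S, ¬ e.IsDiag) {x y : V}
    (hxy : x ≠ y) (h : ∀ v, v ≠ x → v ≠ y → edgeParity S v = 0) :
    edgeParity S x + edgeParity S y = 0 := by
  have hsum := sum_edgeParity hS (U := S.biUnion Sym2.toFinset ∪ {x, y}) (by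
    intro e he v hv
    simp only [Finset.mem_union, Finset.mem_biUnion, Sym2.mem_toFinset]
    exact Or.inl ⟨e, he, hv⟩)
  rw [← Finset.sum_subset (s₁ := {x, y}) Finset.subset_union_right, Finset.sum_pair hxy] at hsum
  · exact hsum
  · intro v _ hv
    simp only [Finset.mem_insert, Finset.mem_singleton, not_or] at hv
    exact h v hv.1 hv.2

theorem isEvenEdgeSet_of_forall_ne {S : Finset (Sym2 V)} (hS : ∀ e ∈ S, ¬ e.IsDiag) {x : V}
    (h : ∀ v, v ≠ x → edgeParity S v = 0) : IsEvenEdgeSet S := by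
  intro v
  by_cases hv : v = x
  · subst hv
    by_cases hy : ∃ y, y ≠ v
    · obtain ⟨y, hy⟩ := hy
      have := edgeParity_add_eq_zero hS hy.symm fun w hw _ => h w hw
      rwa [h y hy, add_zero] at this
    · push Not at hy
      refine edgeParity_eq_zero fun e he _ => hS e he ?_
      induction e using Sym2.ind with
      | _ a b => simp [hy a, hy b]
  · exact h v hv

theorem IsEvenEdgeSet.three_le_card {S : Finset (Sym2 V)} (hS : ∀ e ∈ S, ¬ e.IsDiag)
    (hne : S.Nonempty) (h : IsEvenEdgeSet S) : 3 ≤ S.card := by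
  have key : ∀ e ∈ S, ∀ v ∈ e, ∃ e' ∈ S, e' ≠ e ∧ v ∈ e' := by
    intro e he v hv
    by_contra! hcon
    have := h v
    rw [edgeParity, Finset.sum_eq_single_of_mem e he
      (fun e' he' hne' => by simp [hcon e' he' hne'])] at this
    simp [hv] at this
  obtain ⟨e, he⟩ := hne
  induction e using Sym2.ind with
  | _ a b =>
    obtain ⟨e₁, h₁, hne₁, ha⟩ := key _ he a (by simp)
    obtain ⟨e₂, h₂, hne₂, hb⟩ := key _ he b (by simp)
    have hab : a ≠ b := by simpa using hS _ he
    refine Finset.two_lt_card.2 ⟨_, he, e₁, h₁, e₂, h₂, hne₁.symm, hne₂.symm, ?_⟩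
    rintro rfl
    exact hne₁ ((Sym2.mem_and_mem_iff hab).1 ⟨ha, hb⟩)

/-- If two edge sets overlap in at most one vertex or in one common edge, then every shortest
cycle of the union lies in one of them. -/
theorem subset_or_subset_of_glue {g : ℕ} (hg : 3 ≤ g) {A B : Set (Sym2 V)}
    (hdA : ∀ e ∈ A, ¬ e.IsDiag) (hA : EvenGirthGe g A) (hB : EvenGirthGe g B)
    (h : (∃ x, ∀ v, ∀ a ∈ A, ∀ b ∈ B, v ∈ a → v ∈ b → v = x) ∨
      ∃ x y, x ≠ y ∧ s(x, y) ∈ A ∧ s(x, y) ∈ B ∧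
        ∀ v, ∀ a ∈ A, ∀ b ∈ B, v ∈ a → v ∈ b → v = x ∨ v = y)
    {S : Finset (Sym2 V)} (hS : ↑S ⊆ A ∪ B) (hcard : S.card ≤ g) (heven : IsEvenEdgeSet S) :
    ↑S ⊆ A ∨ ↑S ⊆ B := by
  set P := S.filter (· ∈ A) with hP
  set Q := S.filter (· ∉ A) with hQ
  have hPA : ↑P ⊆ A := fun e he => (Finset.mem_filter.1 he).2
  have hQB : ↑Q ⊆ B := fun e he =>
    (hS (Finset.mem_filter.1 he).1).resolve_left (Finset.mem_filter.1 he).2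
  have hPQ : Disjoint P Q := Finset.disjoint_filter_filter_not S S _
  have hU : P ∪ Q = S := Finset.filter_union_filter_not_eq _ S
  have hsum : ∀ v, edgeParity P v + edgeParity Q v = 0 := fun v => by
    rw [← edgeParity_union hPQ, hU]; exact heven v
  have hc : P.card + Q.card ≤ g := by
    rw [← Finset.card_union_of_disjoint hPQ, hU]; exact hcard
  have hlocal : ∀ v, edgeParity P v = 0 ∨ ∃ a ∈ A, ∃ b ∈ B, v ∈ a ∧ v ∈ b := by
    intro v
    by_cases h₁ : ∀ e ∈ P, v ∉ e
    · exact Or.inl (edgeParity_eq_zero h₁)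
    by_cases h₂ : ∀ e ∈ Q, v ∉ e
    · have := hsum v
      rw [edgeParity_eq_zero h₂, add_zero] at this
      exact Or.inl this
    push Not at h₁ h₂
    obtain ⟨a, ha, hva⟩ := h₁
    obtain ⟨b, hb, hvb⟩ := h₂
    exact Or.inr ⟨a, hPA ha, b, hQB hb, hva, hvb⟩
  have hdone : IsEvenEdgeSet P → ↑S ⊆ A ∨ ↑S ⊆ B := by
    intro hPe
    have hQe : IsEvenEdgeSet Q := fun v => by simpa [hPe v] using hsum v
    rcases P.eq_empty_or_nonempty with h₁ | h₁
    · right; rw [← hU, h₁, Finset.empty_union]; exact hQB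
    rcases Q.eq_empty_or_nonempty with h₂ | h₂
    · left; rw [← hU, h₂, Finset.union_empty]; exact hPA
    have := hA P h₁ hPA hPe
    have := hB Q h₂ hQB hQe
    omega
  rcases h with ⟨x, hx⟩ | ⟨x, y, hxy, hxyA, hxyB, hv⟩
  · refine hdone (isEvenEdgeSet_of_forall_ne (x := x) (fun e he => hdA e (hPA he)) fun v hvx => ?_)
    refine (hlocal v).resolve_right ?_
    rintro ⟨a, ha, b, hb, hva, hvb⟩
    exact hvx (hx v a ha b hb hva hvb)
  have hoff : ∀ v, v ≠ x → v ≠ y → edgeParity P v = 0 := by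
    intro v hvx hvy
    refine (hlocal v).resolve_right ?_
    rintro ⟨a, ha, b, hb, hva, hvb⟩
    exact (hv v a ha b hb hva hvb).elim hvx hvy
  have hadd := edgeParity_add_eq_zero (fun e he => hdA e (hPA he)) hxy hoff
  by_cases hx0 : edgeParity P x = 0
  · refine hdone (isEvenEdgeSet_of_forall_ne (x := y) (fun e he => hdA e (hPA he)) fun v hvy => ?_)
    by_cases hvx : v = x
    · rw [hvx, hx0]
    · exact hoff v hvx hvy
  have hZ : ∀ z : ZMod 2, z ≠ 0 → z = 1 := by decide
  have hZ' : ∀ z : ZMod 2, 1 + z = 0 → z = 1 := by decide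
  have hx1 := hZ _ hx0
  have hy1 : edgeParity P y = 1 := hZ' _ (by rwa [hx1] at hadd)
  have hPpar : ∀ v, edgeParity P v = edgeParity {s(x, y)} v := by
    intro v
    rw [edgeParity_singleton]
    by_cases hvx : v = x
    · simp [hvx, hx1]
    by_cases hvy : v = y
    · simp [hvy, hy1]
    simp [hvx, hvy, hoff v hvx hvy]
  have hsQ : s(x, y) ∉ Q := fun hmem => (Finset.mem_filter.1 hmem).2 hxyA
  have hQ' : g ≤ (Q ∪ {s(x, y)}).card := by
    refine hB _ ⟨s(x, y), by simp⟩ ?_ fun v => ?_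
    · simpa [Set.insert_subset_iff] using ⟨hxyB, hQB⟩
    · rw [edgeParity_union (by simpa using hsQ), ← hPpar, add_comm]
      exact hsum v
  have := Finset.card_union_le Q {s(x, y)}
  rw [Finset.card_singleton] at this
  by_cases hsP : s(x, y) ∈ P
  · have hPe : IsEvenEdgeSet (P.erase s(x, y)) := by
      intro v
      have h₁ : P = P.erase s(x, y) ∪ {s(x, y)} := by
        rw [Finset.union_comm, ← Finset.insert_eq, Finset.insert_erase hsP]
      have h₂ := hPpar v
      rw [h₁, edgeParity_union (by simp)] at h₂
      simpa using h₂
    rcases (P.erase s(x, y)).eq_empty_or_nonempty with h₁ | h₁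
    · right
      rw [← hU]
      intro e he
      rcases Finset.mem_union.1 he with he | he
      · by_cases hes : e = s(x, y)
        · rwa [hes]
        · have := Finset.mem_erase.2 ⟨hes, he⟩
          simp [h₁] at this
      · exact hQB he
    · have h₂ := hA _ h₁ (fun e he => hPA (Finset.mem_of_mem_erase he)) hPe
      have h₃ := Finset.card_erase_lt_of_mem hsP
      omega
  · have hP' : g ≤ (P ∪ {s(x, y)}).card := by
      refine hA _ ⟨s(x, y), by simp⟩ ?_ fun v => ?_
      · simpa [Set.insert_subset_iff] using ⟨hxyA, hPA⟩
      · rw [edgeParity_union (by simpa using hsP), ← hPpar]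
        exact CharTwo.add_self_eq_zero _
    have := Finset.card_union_le P {s(x, y)}
    rw [Finset.card_singleton] at this
    omega

/-- The edge sets `E 0, E 1, …` are glued one after the other along at most one vertex or one
common edge. -/
def EdgeForest {m : ℕ} (E : Fin m → Set (Sym2 V)) : Prop :=
  ∀ j, (∃ x, ∀ v, ∀ i < j, ∀ a ∈ E i, ∀ b ∈ E j, v ∈ a → v ∈ b → v = x) ∨
    ∃ x y, x ≠ y ∧ (∃ i < j, s(x, y) ∈ E i) ∧ s(x, y) ∈ E j ∧
      ∀ v, ∀ i < j, ∀ a ∈ E i, ∀ b ∈ E j, v ∈ a → v ∈ b → v = x ∨ v = y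

theorem EdgeForest.exists_subset {m g : ℕ} (hg : 3 ≤ g) {E : Fin m → Set (Sym2 V)}
    (hE : EdgeForest E) (hd : ∀ i, ∀ e ∈ E i, ¬ e.IsDiag) (hgirth : ∀ i, EvenGirthGe g (E i))
    {S : Finset (Sym2 V)} (hne : S.Nonempty) (hS : ∀ e ∈ S, ∃ i, e ∈ E i) (hcard : S.card ≤ g)
    (heven : IsEvenEdgeSet S) : ∃ i, ↑S ⊆ E i := by
  suffices H : ∀ n ≤ m, ∀ S : Finset (Sym2 V), S.Nonempty →
      (↑S ⊆ {e | ∃ i : Fin m, (i : ℕ) < n ∧ e ∈ E i}) → S.card ≤ g → IsEvenEdgeSet S →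
      ∃ i, ↑S ⊆ E i from
    H m le_rfl S hne (fun e he => (hS e he).imp fun i hi => ⟨i.2, hi⟩) hcard heven
  intro n
  induction n with
  | zero =>
    rintro - S ⟨e, he⟩ hS
    obtain ⟨i, hi, -⟩ := hS he
    omega
  | succ n ih =>
    intro hn S hne hS hcard heven
    have ih := ih (by omega)
    let j : Fin m := ⟨n, hn⟩
    have hglue := subset_or_subset_of_glue hg
      (A := {e | ∃ i : Fin m, (i : ℕ) < n ∧ e ∈ E i}) (B := E j) (S := S)
      (fun e ⟨i, _, he⟩ => hd i e he) ?_ (hgirth j) ?_ ?_ hcard heven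
    · rcases hglue with h | h
      · exact ih S hne h hcard heven
      · exact ⟨j, h⟩
    · intro T hT hTs hTe
      by_contra! hlt
      obtain ⟨i, hi⟩ := ih T hT hTs hlt.le hTe
      exact absurd (hgirth i T hT hi hTe) (by omega)
    · rcases hE j with ⟨x, hx⟩ | ⟨x, y, hxy, ⟨i, hi, hxi⟩, hxj, hv⟩
      · exact Or.inl ⟨x, fun v a ⟨i, hi, ha⟩ b hb => hx v i hi a ha b hb⟩
      · exact Or.inr ⟨x, y, hxy, ⟨i, hi, hxi⟩, hxj,
          fun v a ⟨i, hi, ha⟩ b hb => hv v i hi a ha b hb⟩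
    · intro e he
      obtain ⟨i, hi, hie⟩ := hS he
      rcases Nat.lt_succ_iff_lt_or_eq.1 hi with h | h
      · exact Or.inl ⟨i, h, hie⟩
      · have : i = j := Fin.ext h
        exact Or.inr (this ▸ hie)

theorem EdgeForest.exists_common_edge {m : ℕ} [Nonempty V] {E : Fin m → Set (Sym2 V)}
    (hE : EdgeForest E) (hd : ∀ i, ∀ e ∈ E i, ¬ e.IsDiag) (j : Fin m) :
    ∃ e₀, ∀ i < j, ∀ e ∈ E i, e ∈ E j → e = e₀ := by
  rcases hE j with ⟨x, hx⟩ | ⟨x, y, hxy, -, -, hv⟩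
  · refine ⟨s(x, x), fun i hi e he he' => ?_⟩
    have key := fun v hv => hx v i hi e he e he' hv hv
    induction e using Sym2.ind with
    | _ a b => rw [key a (by simp), key b (by simp)]
  · refine ⟨s(x, y), fun i hi e he he' => ?_⟩
    have key := fun v hw => hv v i hi e he e he' hw hw
    have hdiag := hd i e he
    induction e using Sym2.ind with
    | _ a b =>
      have hab : a ≠ b := by simpa using hdiag
      rcases key a (by simp) with rfl | rfl <;> rcases key b (by simp) with rfl | rfl <;>
        simp_all [Sym2.eq_swap]

/-- An edge set can be `2`-coloured with one edge `e₀` precoloured so that no short cycle through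
`e₀` and no class of edges on short cycles is monochromatic. -/
theorem exists_coloring_of_precolored {g : ℕ} (hg : 3 ≤ g) (E : Set (Sym2 V)) (e₀ : Sym2 V)
    (k : Fin 2) : ∃ c : Sym2 V → Fin 2, c e₀ = k ∧
      (∀ S, IsShortCycle g E S → e₀ ∈ S → ¬ IsMono c ↑S) ∧
      ∀ S, IsShortCycle g E S → ∀ e ∈ S, ¬ IsMono c {f | cycleSetoid g E e f} := by
  let r : Quotient (cycleSetoid g E) → Sym2 V := fun q => if q = ⟦e₀⟧ then e₀ else q.out
  have hr : ∀ q, (⟦r q⟧ : Quotient (cycleSetoid g E)) = q := by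
    intro q
    by_cases h : q = ⟦e₀⟧ <;> simp [r, h]
  have hr₀ : r ⟦e₀⟧ = e₀ := by simp [r]
  let c : Sym2 V → Fin 2 := fun e => if e = r ⟦e⟧ then k else k + 1
  have hk : k + 1 ≠ k := by revert k; decide
  have hother : ∀ S, IsShortCycle g E S → ∀ e ∈ S, ∀ z, ∃ f ∈ S, f ≠ z ∧
      cycleSetoid g E e f := by
    intro S hS e he z
    obtain ⟨f, hf, hne⟩ := Finset.exists_mem_ne (by rw [hS.card]; omega : 1 < S.card) z
    exact ⟨f, hf, hne, Relation.ReflTransGen.single ⟨S, hS, he, hf⟩⟩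
  have hrep : ∀ q, c (r q) = k := fun q => by simp [c, hr]
  refine ⟨c, by simpa [hr₀] using hrep ⟦e₀⟧, ?_, ?_⟩
  · rintro S hS he ⟨l, hl⟩
    obtain ⟨f, hf, hne, hrel⟩ := hother S hS e₀ he e₀
    have h₁ : (⟦f⟧ : Quotient (cycleSetoid g E)) = ⟦e₀⟧ := (Quotient.sound hrel).symm
    have h₂ : c f = k + 1 := by simp [c, h₁, hr₀, hne]
    have h₃ : c e₀ = k := by simpa [hr₀] using hrep ⟦e₀⟧
    exact hk (by rw [← h₂, ← h₃, hl _ he, hl _ hf])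
  · rintro S hS e he ⟨l, hl⟩
    obtain ⟨f, hf, hne, hrel⟩ := hother S hS e he (r ⟦e⟧)
    have h₁ : (⟦f⟧ : Quotient (cycleSetoid g E)) = ⟦e⟧ := (Quotient.sound hrel).symm
    have h₂ : c f = k + 1 := by simp [c, h₁, hne]
    have h₃ : cycleSetoid g E e (r ⟦e⟧) := Quotient.exact (hr ⟦e⟧).symm
    exact hk (by rw [← h₂, hl _ hrel, ← hl _ h₃, hrep])

theorem IsMono.congr {K : Type*} {c c' : Sym2 V → K} {T : Set (Sym2 V)}
    (h : ∀ e ∈ T, c e = c' e) (hT : IsMono c T) : IsMono c' T :=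
  hT.imp fun _ hk e he => (h e he).symm.trans (hk e he)

theorem IsShortCycle.class_subset {g : ℕ} {E : Set (Sym2 V)} {S : Finset (Sym2 V)}
    (hS : IsShortCycle g E S) {e : Sym2 V} (he : e ∈ S) : {f | cycleSetoid g E e f} ⊆ E := by
  intro f hf
  rcases Relation.ReflTransGen.cases_tail hf with rfl | ⟨_, _, T, hT, _, hfT⟩
  · exact hS.subset he
  · exact hT.subset hfT

theorem EdgeForest.exists_coloring {m g : ℕ} [Nonempty V] (hg : 3 ≤ g) {E : Fin m → Set (Sym2 V)}
    (hE : EdgeForest E) (hd : ∀ i, ∀ e ∈ E i, ¬ e.IsDiag) : ∃ c : Sym2 V → Fin 2, ∀ j,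
      (∀ S, IsShortCycle g (E j) S → (∃ i < j, ∃ e ∈ S, e ∈ E i) → ¬ IsMono c ↑S) ∧
      ∀ S, IsShortCycle g (E j) S → ∀ e ∈ S, ¬ IsMono c {f | cycleSetoid g (E j) e f} := by
  suffices H : ∀ n ≤ m, ∃ c : Sym2 V → Fin 2, ∀ j : Fin m, (j : ℕ) < n →
      (∀ S, IsShortCycle g (E j) S → (∃ i < j, ∃ e ∈ S, e ∈ E i) → ¬ IsMono c ↑S) ∧
      ∀ S, IsShortCycle g (E j) S → ∀ e ∈ S, ¬ IsMono c {f | cycleSetoid g (E j) e f} from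
    (H m le_rfl).imp fun c hc j => hc j j.2
  intro n
  induction n with
  | zero => exact fun _ => ⟨fun _ => 0, fun j hj => by omega⟩
  | succ n ih =>
    intro hn
    obtain ⟨c, hc⟩ := ih (by omega)
    let l : Fin m := ⟨n, hn⟩
    obtain ⟨e₀, he₀⟩ := hE.exists_common_edge hd l
    obtain ⟨c', hc₀, hc₁, hc₂⟩ := exists_coloring_of_precolored hg (E l) e₀ (c e₀)
    let c'' : Sym2 V → Fin 2 := fun e => if ∃ i < l, e ∈ E i then c e else c' e
    have hold : ∀ i < l, ∀ e ∈ E i, c'' e = c e := fun i hi e he => if_pos ⟨i, hi, he⟩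
    have hnew : ∀ e ∈ E l, c'' e = c' e := by
      intro e he
      by_cases h : ∃ i < l, e ∈ E i
      · obtain ⟨i, hi, hie⟩ := h
        rw [hold i hi e hie, he₀ i hi e hie he, hc₀]
      · exact if_neg h
    refine ⟨c'', fun j hj => ?_⟩
    rcases Nat.lt_succ_iff_lt_or_eq.1 hj with hj | hj
    · refine ⟨fun S hS h hm => (hc j hj).1 S hS h ?_, fun S hS e he hm => (hc j hj).2 S hS e he ?_⟩
      · exact hm.congr fun f hf => hold j hj f (hS.subset hf)
      · exact hm.congr fun f hf => hold j hj f (hS.class_subset he hf)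
    · obtain rfl : j = l := Fin.ext hj
      refine ⟨?_, fun S hS e he hm => hc₂ S hS e he ?_⟩
      · rintro S hS ⟨i, hi, e, he, hie⟩ hm
        obtain rfl := he₀ i hi e hie (hS.subset he)
        exact hc₁ S hS he (hm.congr fun f hf => hnew f (hS.subset hf))
      · exact hm.congr fun f hf => hnew f (hS.class_subset he hf)

theorem isEvenEdgeSet_map_iff (φ : W ↪ V) (S : Finset (Sym2 W)) :
    IsEvenEdgeSet (S.map φ.sym2Map) ↔ IsEvenEdgeSet S := by
  have h : ∀ w, edgeParity (S.map φ.sym2Map) (φ w) = edgeParity S w := by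
    intro w
    rw [edgeParity, Finset.sum_map]
    refine Finset.sum_congr rfl fun e _ => ?_
    have : φ w ∈ φ.sym2Map e ↔ w ∈ e := by
      simp [Sym2.mem_map]
    simp only [this]
  refine ⟨fun hS w => by rw [← h, hS], fun hS v => ?_⟩
  by_cases hv : ∃ w, φ w = v
  · obtain ⟨w, rfl⟩ := hv
    rw [h, hS]
  · refine edgeParity_eq_zero fun e he hve => hv ?_
    obtain ⟨e', -, rfl⟩ := Finset.mem_map.1 he
    obtain ⟨w, -, hw⟩ := Sym2.mem_map.1 hve
    exact ⟨w, hw⟩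

theorem exists_map_eq_of_subset_image (φ : W ↪ V) {D : Set (Sym2 W)} {S : Finset (Sym2 V)}
    (hS : ↑S ⊆ φ.sym2Map '' D) : ∃ T : Finset (Sym2 W), ↑T ⊆ D ∧ T.map φ.sym2Map = S := by
  obtain ⟨T, hT, rfl⟩ := Finset.subset_set_image_iff.1 hS
  exact ⟨T, hT, Finset.map_eq_image _ _⟩

theorem EvenGirthGe.image {g : ℕ} {D : Set (Sym2 W)} (hD : EvenGirthGe g D) (φ : W ↪ V) :
    EvenGirthGe g (φ.sym2Map '' D) := by
  intro S hne hS heven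
  obtain ⟨T, hT, rfl⟩ := exists_map_eq_of_subset_image φ hS
  rw [Finset.card_map]
  exact hD T (Finset.map_nonempty.1 hne) hT ((isEvenEdgeSet_map_iff φ T).1 heven)

theorem IsShortCycle.exists_map_eq {g : ℕ} {D : Set (Sym2 W)} {φ : W ↪ V} {S : Finset (Sym2 V)}
    (hS : IsShortCycle g (φ.sym2Map '' D) S) :
    ∃ T, IsShortCycle g D T ∧ T.map φ.sym2Map = S := by
  obtain ⟨T, hT, rfl⟩ := exists_map_eq_of_subset_image φ hS.subset
  exact ⟨T, ⟨hT, by simpa using hS.card, (isEvenEdgeSet_map_iff φ T).1 hS.even⟩, rfl⟩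

theorem class_image_subset {g : ℕ} {D : Set (Sym2 W)} (φ : W ↪ V) (e : Sym2 W) :
    {f | cycleSetoid g (φ.sym2Map '' D) (φ.sym2Map e) f} ⊆
      φ.sym2Map '' {f | cycleSetoid g D e f} := by
  intro f hf
  induction hf with
  | refl => exact ⟨e, .refl, rfl⟩
  | tail _ hstep ih =>
    obtain ⟨a, ha, rfl⟩ := ih
    obtain ⟨S, hS, haS, hfS⟩ := hstep
    obtain ⟨T, hT, rfl⟩ := hS.exists_map_eq
    obtain ⟨b, hb, rfl⟩ := Finset.mem_map.1 hfS
    exact ⟨b, Relation.ReflTransGen.tail ha ⟨T, hT, (Finset.mem_map' _).1 haS, hb⟩, rfl⟩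

/-- A union of edge sets glued in a forest-like fashion, each a copy of a finite loopless edge set
`D` containing a cycle, has a `2`-colouring without a monochromatic copy of `D`. -/
theorem EdgeForest.exists_coloring_forall_not_isMono {m : ℕ} [Finite W] [Nonempty V]
    {D : Set (Sym2 W)} (hD : ∀ e ∈ D, ¬ e.IsDiag)
    (hcycle : ∃ S : Finset (Sym2 W), S.Nonempty ∧ ↑S ⊆ D ∧ IsEvenEdgeSet S)
    {E : Fin m → Set (Sym2 V)} (hE : EdgeForest E)
    (hcopy : ∀ i, ∃ ψ : W ↪ V, E i = ψ.sym2Map '' D) :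
    ∃ c : Sym2 V → Fin 2, ∀ φ : W ↪ V, (∀ e ∈ D, ∃ i, φ.sym2Map e ∈ E i) →
      ¬ IsMono c (φ.sym2Map '' D) := by
  have hd : ∀ i, ∀ e ∈ E i, ¬ e.IsDiag := by
    intro i e he
    obtain ⟨ψ, hψ⟩ := hcopy i
    rw [hψ] at he
    obtain ⟨f, hf, rfl⟩ := he
    have := hD f hf
    induction f using Sym2.ind with
    | _ a b => simpa using this
  obtain ⟨g, ⟨C, hCne, hCD, hCe, hCg⟩, hmin⟩ : ∃ g, (∃ S : Finset (Sym2 W), S.Nonempty ∧ ↑S ⊆ D ∧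
      IsEvenEdgeSet S ∧ S.card = g) ∧ EvenGirthGe g D := by
    have hex : ∃ g, ∃ S : Finset (Sym2 W), S.Nonempty ∧ ↑S ⊆ D ∧ IsEvenEdgeSet S ∧ S.card = g := by
      obtain ⟨S, h₁, h₂, h₃⟩ := hcycle
      exact ⟨_, S, h₁, h₂, h₃, rfl⟩
    exact ⟨Nat.find hex, Nat.find_spec hex,
      fun S h₁ h₂ h₃ => Nat.find_min' hex ⟨S, h₁, h₂, h₃, rfl⟩⟩
  have hg : 3 ≤ g := hCg ▸ hCe.three_le_card (fun e he => hD e (hCD he)) hCne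
  have hgirth : ∀ i, EvenGirthGe g (E i) := fun i => by
    obtain ⟨ψ, hψ⟩ := hcopy i
    rw [hψ]
    exact hmin.image ψ
  obtain ⟨c, hc⟩ := hE.exists_coloring hg hd
  refine ⟨c, fun φ hφ hmono => ?_⟩
  obtain ⟨e₀, ⟨S₀, hS₀, heS₀⟩, hmax⟩ := Set.exists_max_image {e | ∃ S, IsShortCycle g D S ∧ e ∈ S}
    (fun e => Set.ncard {f | cycleSetoid g D e f}) (Set.toFinite _)
    (by obtain ⟨e, he⟩ := hCne; exact ⟨e, C, ⟨hCD, hCg, hCe⟩, he⟩)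
  have hmonoS : ∀ S, IsShortCycle g D S → IsMono c ↑(S.map φ.sym2Map) := fun S hS =>
    hmono.imp fun k hk e he => by
      obtain ⟨f, hf, rfl⟩ := Finset.mem_map.1 he
      exact hk _ ⟨f, hS.subset hf, rfl⟩
  have hin : ∀ S, IsShortCycle g D S → ∃ i, IsShortCycle g (E i) (S.map φ.sym2Map) := by
    intro S hS
    have heven := (isEvenEdgeSet_map_iff φ S).2 hS.even
    have hcard : (S.map φ.sym2Map).card = g := by simpa using hS.card
    obtain ⟨i, hi⟩ := hE.exists_subset hg hd hgirth (S := S.map φ.sym2Map)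
      (Finset.card_pos.1 (by omega))
      (fun e he => by
        obtain ⟨f, hf, rfl⟩ := Finset.mem_map.1 he
        exact hφ f (hS.subset hf))
      hcard.le heven
    exact ⟨i, hi, hcard, heven⟩
  obtain ⟨j, hj⟩ := hin S₀ hS₀
  have hstep : ∀ S, IsShortCycle g D S → ∀ e ∈ S, ∀ T, IsShortCycle g D T → e ∈ T →
      IsShortCycle g (E j) (S.map φ.sym2Map) → IsShortCycle g (E j) (T.map φ.sym2Map) := by
    intro S hS e heS T hT heT hSj
    obtain ⟨i, hi⟩ := hin T hT
    have heS' := Finset.mem_map_of_mem φ.sym2Map heS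
    have heT' := Finset.mem_map_of_mem φ.sym2Map heT
    rcases lt_trichotomy i j with hij | rfl | hij
    · exact ((hc j).1 _ hSj ⟨i, hij, _, heS', hi.subset heT'⟩ (hmonoS S hS)).elim
    · exact hi
    · exact ((hc i).1 _ hi ⟨j, hij, _, heT', hSj.subset heS'⟩ (hmonoS T hT)).elim
  have hclass : ∀ f, cycleSetoid g D e₀ f →
      (∃ S, IsShortCycle g D S ∧ f ∈ S ∧ IsShortCycle g (E j) (S.map φ.sym2Map)) ∧
      cycleSetoid g (E j) (φ.sym2Map e₀) (φ.sym2Map f) := by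
    intro f hf
    induction hf with
    | refl => exact ⟨⟨S₀, hS₀, heS₀, hj⟩, .refl⟩
    | tail _ h ih =>
      obtain ⟨⟨S, hS, haS, hSj⟩, hrel⟩ := ih
      obtain ⟨T, hT, haT, hbT⟩ := h
      have hTj := hstep S hS _ haS T hT haT hSj
      exact ⟨⟨T, hT, hbT, hTj⟩, Relation.ReflTransGen.tail hrel
        ⟨_, hTj, Finset.mem_map_of_mem _ haT, Finset.mem_map_of_mem _ hbT⟩⟩
  have hsub : φ.sym2Map '' {f | cycleSetoid g D e₀ f} ⊆
      {f | cycleSetoid g (E j) (φ.sym2Map e₀) f} := by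
    rintro _ ⟨f, hf, rfl⟩
    exact (hclass f hf).2
  refine (hc j).2 _ hj _ (Finset.mem_map_of_mem _ heS₀) ?_
  obtain ⟨ψ, hψ⟩ := hcopy j
  rw [hψ] at hj hsub ⊢
  obtain ⟨T, hT, hTeq⟩ := hj.exists_map_eq
  obtain ⟨e₁, he₁, he₁eq⟩ := Finset.mem_map.1 (hTeq ▸ Finset.mem_map_of_mem φ.sym2Map heS₀)
  have hsub' := class_image_subset (g := g) (D := D) ψ e₁
  rw [he₁eq] at hsub'
  have hcard : Set.ncard {f | cycleSetoid g (ψ.sym2Map '' D) (φ.sym2Map e₀) f} ≤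
      Set.ncard (φ.sym2Map '' {f | cycleSetoid g D e₀ f}) :=
    calc _ ≤ _ := Set.ncard_le_ncard hsub' (Set.toFinite _)
      _ = _ := Set.ncard_image_of_injective _ ψ.sym2Map.injective
      _ ≤ _ := hmax e₁ ⟨T, hT, he₁⟩
      _ = _ := (Set.ncard_image_of_injective _ φ.sym2Map.injective).symm
  rw [← Set.eq_of_subset_of_ncard_le hsub hcard ((Set.toFinite _).subset hsub')]
  obtain ⟨k, hk⟩ := hmono
  refine ⟨k, ?_⟩
  rintro _ ⟨f, hf, rfl⟩
  exact hk _ ⟨f, hS₀.class_subset heS₀ hf, rfl⟩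

theorem exists_isEvenEdgeSet_of_not_isAcyclic {F : SimpleGraph W} (hF : ¬ F.IsAcyclic) :
    ∃ S : Finset (Sym2 W), S.Nonempty ∧ ↑S ⊆ F.edgeSet ∧ IsEvenEdgeSet S := by
  simp only [SimpleGraph.IsAcyclic, not_forall, not_not] at hF
  obtain ⟨v, p, hp⟩ := hF
  refine ⟨p.edges.toFinset, ?_, fun e he => p.edges_subset_edgeSet (by simpa using he),
    fun w => ?_⟩
  · rw [List.toFinset_nonempty_iff, ← List.length_pos_iff, SimpleGraph.Walk.length_edges]
    have := hp.three_le_length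
    omega
  · have h := (hp.isTrail.even_countP_edges_iff w).2 (fun h => absurd rfl h)
    rw [edgeParity, Finset.sum_boole, ZMod.natCast_eq_zero_iff_even]
    rw [List.countP_eq_length_filter] at h
    rw [← List.toFinset_card_of_nodup (hp.isTrail.edges_nodup.filter _), List.toFinset_filter] at h
    simpa using h

theorem ForestCond.edgeForest {m : ℕ} {G : SimpleGraph V} [Nonempty V] {F : Fin m → G.Subgraph}
    (hF : ForestCond F) : EdgeForest fun i => (F i).edgeSet := by
  have hmem : ∀ {i j v a b}, i < j → a ∈ (F i).edgeSet → b ∈ (F j).edgeSet → v ∈ a → v ∈ b →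
      v ∈ (F j).verts ∩ ⋃ (i : Fin m) (_ : i < j), (F i).verts := by
    intro i j v a b hij ha hb hva hvb
    refine ⟨(F j).mem_verts_of_mem_edge hb hvb, ?_⟩
    simp only [Set.mem_iUnion]
    exact ⟨i, hij, (F i).mem_verts_of_mem_edge ha hva⟩
  intro j
  by_cases hj : (j : ℕ) = 0
  · refine Or.inl ⟨Classical.arbitrary V, fun v i hi => ?_⟩
    have : (i : ℕ) < j := hi
    omega
  rcases hF j hj with h | ⟨x, h⟩ | ⟨x, y, hj, ⟨i, hi, hxi⟩, h⟩
  · refine Or.inl ⟨Classical.arbitrary V, fun v i hi a ha b hb hva hvb => ?_⟩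
    have := hmem hi ha hb hva hvb
    rw [h] at this
    exact this.elim
  · refine Or.inl ⟨x, fun v i hi a ha b hb hva hvb => ?_⟩
    have := hmem hi ha hb hva hvb
    rwa [h] at this
  · refine Or.inr ⟨x, y, hj.ne, ⟨i, hi, by simpa using hxi⟩, by simpa using hj,
      fun v i hi a ha b hb hva hvb => ?_⟩
    have := hmem hi ha hb hva hvb
    rwa [h] at this

theorem exists_edgeSet_eq_image {G : SimpleGraph V} {F : SimpleGraph W} {H : G.Subgraph}
    (h : H.coe ≃g F) : ∃ ψ : W ↪ V, H.edgeSet = ψ.sym2Map '' F.edgeSet := by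
  refine ⟨h.symm.toEquiv.toEmbedding.trans (Function.Embedding.subtype _), ?_⟩
  ext e
  induction e using Sym2.ind with
  | _ a b =>
    constructor
    · intro hab
      have hab : H.Adj a b := hab
      let u : H.verts := ⟨a, hab.fst_mem⟩
      let v : H.verts := ⟨b, hab.snd_mem⟩
      have : F.Adj (h u) (h v) := h.map_adj_iff.2 hab
      refine ⟨s(h u, h v), this, ?_⟩
      simp [u, v]
    · rintro ⟨e, he, heq⟩
      induction e using Sym2.ind with
      | _ u v =>
        have : H.Adj (h.symm u) (h.symm v) := h.symm.map_adj_iff.2 he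
        rw [← heq]
        exact this

end EdgeSets

/-- For every graph `F` containing a cycle and every nonempty forest `𝒻` of copies
of `F`, the union graph `⋃𝒻` does not arrow `F` with two colours: some `2`-colouring
of its edges yields no monochromatic subgraph isomorphic to `F`. -/
theorem forest_of_copies_not_ramsey {α : Type} [Fintype α] (F : SimpleGraph α)
    (hF : ¬ F.IsAcyclic)
    (𝒻 : Set (Subgraph (⊤ : SimpleGraph ℕ))) (hne : 𝒻.Nonempty)
    (hforest : IsForestOfCopies 𝒻)
    (hcopies : ∀ H ∈ 𝒻, Nonempty (H.coe ≃g F)) :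
    ¬ ArrowNNI (sSup 𝒻 : Subgraph (⊤ : SimpleGraph ℕ)).coe F 2 := by
  obtain ⟨m, E, -, hE, hcond⟩ := hforest
  obtain ⟨c, hc⟩ := hcond.edgeForest.exists_coloring_forall_not_isMono
    (D := F.edgeSet) (fun _ he => F.not_isDiag_of_mem_edgeSet he)
    (exists_isEvenEdgeSet_of_not_isAcyclic hF)
    (fun i => exists_edgeSet_eq_image (hcopies (E i) ((hE _).2 ⟨i, rfl⟩)).some)
  intro harrow
  obtain ⟨f, hf, k, hk⟩ := harrow fun e => c (e.map Subtype.val)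
  refine hc ((⟨f, hf⟩ : α ↪ _).trans (Function.Embedding.subtype _)) (fun e he => ?_) ⟨k, ?_⟩
  · induction e using Sym2.ind with
    | _ a b =>
      have hab : (sSup 𝒻 : Subgraph (⊤ : SimpleGraph ℕ)).Adj (f a) (f b) := f.map_adj he
      obtain ⟨H, hH, hadj⟩ := Subgraph.sSup_adj.1 hab
      obtain ⟨i, rfl⟩ := (hE H).1 hH
      exact ⟨i, hadj⟩
  · rintro _ ⟨e, he, rfl⟩
    induction e using Sym2.ind with
    | _ a b => exact hk a b he
end
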